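/- Let M be a weight sequence satisfying (M.2) and (M.2)*. Then 𝒦^{(M)}(ℝ^d) ∗ 𝒦^{(M)}(ℝ^d) = 𝒦^{(M)}(ℝ^d) and 𝒦^{{M}}(ℝ^d) ∗ 𝒦^{{M}}(ℝ^d) = 𝒦^{{M}}(ℝ^d); in particular, every φ ∈ 𝒦^{[M]}(ℝ^d) can be written as φ = ψ ∗ χ with ψ, χ ∈ 𝒦^{[M]}(ℝ^d), and every such convolution lies in 𝒦^{[M]}(ℝ^d). Moreover, in the Beurling case, for every set B ⊆ 𝒦^{(M)}(ℝ^d) with all seminorms p_{h,n}(φ) := sup_α sup_x h^{|α|}|∂^αφ(x)|e^{n|x|}/M_α uniformly bounded on B (for every h > 0 and n ∈ ℕ), there are ψ ∈ 𝒦^{(M)}(ℝ^d) and a bounded set A ⊆ 𝒦^{(M)}(ℝ^d) with ψ ∗ A = B; in the Roumieu case, for every B ⊆ 𝒦^{{M}}(ℝ^d) such that for some h > 0 and all n ∈ ℕ, sup_{φ∈B} p_{h,n}(φ) < ∞, there are ψ ∈ 𝒦^{{M}}(ℝ^d) and a bounded set A ⊆ 𝒦^{{M}}(ℝ^d) with ψ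 ∗ A = B. -/

import Mathlib

open Filter MeasureTheory
open scoped BigOperators

noncomputable section

abbrev Rd (d : ℕ) := EuclideanSpace ℝ (Fin d)

/-- Partial derivative in the `j`-th coordinate direction. -/
def dop {d : ℕ} {E : Type*} [NormedAddCommGroup E] [NormedSpace ℝ E]
    (j : Fin d) (f : Rd d → E) : Rd d → E :=
  fun x => fderiv ℝ f x (EuclideanSpace.single j (1:ℝ))

/-- Iterated partial derivative `∂^α` for a multi-index `α : Fin d → ℕ`. -/
def pD {d : ℕ} {E : Type*} [NormedAddCommGroup E] [NormedSpace ℝ E]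
    (α : Fin d → ℕ) (f : Rd d → E) : Rd d → E :=
  (List.finRange d).foldr (fun j g => (dop j)^[α j] g) f

/-- Length `|α|` of a multi-index. -/
def msize {d : ℕ} (α : Fin d → ℕ) : ℕ := ∑ j, α j

/-- `M` is a weight sequence: positive, normalized, `M_p^{1/p} → ∞`, log-convex. -/
def IsWeightSeq (M : ℕ → ℝ) : Prop :=
  (∀ p, 0 < M p) ∧ M 0 = 1 ∧ M 1 = 1 ∧
  Tendsto (fun p : ℕ => (M p) ^ ((p : ℝ)⁻¹)) atTop atTop ∧
  ∀ p : ℕ, 1 ≤ p → (M p)^2 ≤ M (p-1) * M (p+1)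

/-- Condition (M.2) with explicit constants `C₀, H ≥ 1`. -/
def HasM2 (M : ℕ → ℝ) (C₀ H : ℝ) : Prop :=
  1 ≤ C₀ ∧ 1 ≤ H ∧ ∀ p q : ℕ, M (p+q) ≤ C₀ * H^(p+q) * M p * M q

/-- Condition (M.2). -/
def M2 (M : ℕ → ℝ) : Prop := ∃ C₀ H, HasM2 M C₀ H

/-- Condition (M.2)*: `2 m_p ≤ m_{Np}` for `p ≥ p₀`. -/
def M2star (M : ℕ → ℝ) : Prop :=
  ∃ p₀ N : ℕ, 0 < p₀ ∧ 0 < N ∧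
    ∀ p, p₀ ≤ p → 2 * (M p / M (p-1)) ≤ M (N*p) / M (N*p - 1)

/-- Associated function `ν_M(t) = sup_p log(t^p / M_p)`. -/
def nuA (M : ℕ → ℝ) (t : ℝ) : ℝ := ⨆ p : ℕ, Real.log (t ^ p / M p)

/-- `φ ∈ 𝒦^{(M)}(ℝ^d)` (Beurling type). -/
def KBeu (d : ℕ) (M : ℕ → ℝ) (φ : Rd d → ℂ) : Prop :=
  ContDiff ℝ (⊤ : ℕ∞) φ ∧ ∀ k : ℝ, 0 < k → ∀ n : ℕ, ∃ C : ℝ,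
    ∀ (α : Fin d → ℕ) (x : Rd d),
      k ^ msize α * ‖pD α φ x‖ * Real.exp ((n : ℝ) * ‖x‖) ≤ C * M (msize α)

/-- `φ ∈ 𝒦^{{M}}(ℝ^d)` (Roumieu type). -/
def KRou (d : ℕ) (M : ℕ → ℝ) (φ : Rd d → ℂ) : Prop :=
  ContDiff ℝ (⊤ : ℕ∞) φ ∧ ∃ k : ℝ, 0 < k ∧ ∀ n : ℕ, ∃ C : ℝ,
    ∀ (α : Fin d → ℕ) (x : Rd d),
      k ^ msize α * ‖pD α φ x‖ * Real.exp ((n : ℝ) * ‖x‖) ≤ C * M (msize α)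

/-- Convolution `(ψ ∗ χ)(x) = ∫ ψ(t) χ(x - t) dt`. -/
def convF {d : ℕ} (ψ χ : Rd d → ℂ) : Rd d → ℂ := fun x => ∫ t : Rd d, ψ t * χ (x - t)

/-- The set of all convolutions `ψ ∗ χ` with `ψ ∈ X`, `χ ∈ Y`. -/
def convSet {d : ℕ} (X Y : Set (Rd d → ℂ)) : Set (Rd d → ℂ) :=
  {f | ∃ ψ ∈ X, ∃ χ ∈ Y, f = convF ψ χ}

/-- Bounded subset of `𝒦^{(M)}(ℝ^d)`: all seminorms `p_{h,n}` uniformly bounded. -/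
def KBeuBdd (d : ℕ) (M : ℕ → ℝ) (B : Set (Rd d → ℂ)) : Prop :=
  (∀ φ ∈ B, KBeu d M φ) ∧ ∀ h : ℝ, 0 < h → ∀ n : ℕ, ∃ C : ℝ,
    ∀ φ ∈ B, ∀ (α : Fin d → ℕ) (x : Rd d),
      h ^ msize α * ‖pD α φ x‖ * Real.exp ((n : ℝ) * ‖x‖) ≤ C * M (msize α)

/-- Bounded subset of `𝒦^{{M}}(ℝ^d)`: for some `h > 0` the seminorms `p_{h,n}` are
uniformly bounded for every `n`. -/
def KRouBdd (d : ℕ) (M : ℕ → ℝ) (B : Set (Rd d → ℂ)) : Prop :=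
  (∀ φ ∈ B, KRou d M φ) ∧ ∃ h : ℝ, 0 < h ∧ ∀ n : ℕ, ∃ C : ℝ,
    ∀ φ ∈ B, ∀ (α : Fin d → ℕ) (x : Rd d),
      h ^ msize α * ‖pD α φ x‖ * Real.exp ((n : ℝ) * ‖x‖) ≤ C * M (msize α)


/-- The weight function `W(t) = sup_p t^p / M_p`, extended by `W(0)` to negative `t`. -/
def assocW (M : ℕ → ℝ) (t : ℝ) : ℝ := ⨆ p : ℕ, (max t 0) ^ p / M p

namespace IsWeightSeq

variable {M : ℕ → ℝ}

lemma pos (hM : IsWeightSeq M) (p : ℕ) : 0 < M p := hM.1 p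

lemma eventually_pow_le (hM : IsWeightSeq M) {t : ℝ} (ht : 0 ≤ t) :
    ∀ᶠ p in atTop, t ^ p ≤ M p := by
  filter_upwards [hM.2.2.2.1.eventually_ge_atTop t, eventually_gt_atTop 0] with p hp hp0
  calc t ^ p ≤ (M p ^ ((p : ℝ)⁻¹)) ^ p := by gcongr
    _ = M p := Real.rpow_inv_natCast_pow (hM.pos p).le hp0.ne'

lemma bddAbove (hM : IsWeightSeq M) (t : ℝ) :
    BddAbove (Set.range fun p : ℕ => (max t 0) ^ p / M p) := by
  apply Filter.IsBoundedUnder.bddAbove_range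
  refine ⟨1, ?_⟩
  simp only [eventually_map]
  filter_upwards [hM.eventually_pow_le (le_max_right t 0)] with p hp
  rw [div_le_one (hM.pos p)]
  exact hp

lemma pow_le (hM : IsWeightSeq M) {t : ℝ} (ht : 0 ≤ t) (p : ℕ) :
    t ^ p ≤ M p * assocW M t := by
  have := le_ciSup (hM.bddAbove t) p
  simp only [max_eq_left ht] at this
  rw [div_le_iff₀ (hM.pos p)] at this
  rw [mul_comm]
  simpa [assocW, max_eq_left ht] using this

lemma one_le_assocW (hM : IsWeightSeq M) (t : ℝ) : 1 ≤ assocW M t := by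
  have := le_ciSup (hM.bddAbove t) 0
  simp only [pow_zero, hM.2.1, div_one] at this
  exact this

lemma assocW_pos (hM : IsWeightSeq M) (t : ℝ) : 0 < assocW M t :=
  zero_lt_one.trans_le (hM.one_le_assocW t)

lemma assocW_mono (hM : IsWeightSeq M) : Monotone (assocW M) := by
  intro s t hst
  refine ciSup_mono (hM.bddAbove t) fun p => ?_
  have := (hM.pos p).le
  gcongr

lemma assocW_mul_le (hM : IsWeightSeq M) {t y D : ℝ} (ht : 0 ≤ t) (hy : 0 ≤ y)
    (h : ∀ p, t ^ p * y ≤ D * M p) : assocW M t * y ≤ D := by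
  unfold assocW
  rw [Real.iSup_mul_of_nonneg hy]
  refine ciSup_le fun p => ?_
  rw [max_eq_left ht, div_mul_eq_mul_div, div_le_iff₀ (hM.pos p)]
  exact h p

lemma assocW_sq_le (hM : IsWeightSeq M) {C₀ H : ℝ} (h2 : HasM2 M C₀ H) {t : ℝ} (ht : 0 ≤ t) :
    assocW M t ^ 2 ≤ C₀ * assocW M (H * t) := by
  obtain ⟨hC, hH, h2⟩ := h2
  rw [sq]
  refine hM.assocW_mul_le ht (hM.assocW_pos t).le fun p => ?_
  rw [mul_comm]
  refine hM.assocW_mul_le ht (by positivity) fun q => ?_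
  have hHt : 0 ≤ H * t := by positivity
  calc t ^ q * t ^ p = t ^ (p + q) := by ring
    _ ≤ C₀ * assocW M (H * t) * M p * M q := by
      have h3 := hM.pow_le hHt (p + q)
      have h4 := (hM.assocW_pos (H * t)).le
      have h5 : (H * t) ^ (p + q) ≤ H ^ (p + q) * (C₀ * assocW M (H * t) * M p * M q) := by
        refine h3.trans ?_
        calc M (p + q) * assocW M (H * t)
            ≤ (C₀ * H ^ (p + q) * M p * M q) * assocW M (H * t) := by gcongr; exact h2 p q
          _ = _ := by ring
      rw [mul_pow] at h5
      exact le_of_mul_le_mul_left h5 (by positivity)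
    _ = _ := by ring

lemma div_le_div_succ (hM : IsWeightSeq M) (p : ℕ) :
    M p / M (p - 1) ≤ M (p + 1) / M p := by
  rcases Nat.eq_zero_or_pos p with rfl | hp
  · simp [hM.2.1, hM.2.2.1]
  · rw [div_le_div_iff₀ (hM.pos _) (hM.pos _), ← sq, mul_comm]
    exact hM.2.2.2.2 p hp

lemma ratio_mono (hM : IsWeightSeq M) : Monotone fun p : ℕ => M p / M (p - 1) :=
  monotone_nat_of_le_succ hM.div_le_div_succ

lemma one_le_ratio (hM : IsWeightSeq M) (p : ℕ) : 1 ≤ M p / M (p - 1) := by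
  have := hM.ratio_mono (Nat.zero_le p)
  simpa [hM.2.1] using this

lemma mul_ratio_pow_le (hM : IsWeightSeq M) (q r : ℕ) :
    M q * (M q / M (q - 1)) ^ r ≤ M (q + r) := by
  induction r with
  | zero => simp
  | succ r ih =>
    have h1 := hM.ratio_mono (show q ≤ q + r + 1 by omega)
    have h0 := hM.one_le_ratio q
    simp only [Nat.add_sub_cancel] at h1
    calc M q * (M q / M (q - 1)) ^ (r + 1)
        = (M q * (M q / M (q - 1)) ^ r) * (M q / M (q - 1)) := by ring
      _ ≤ M (q + r) * (M (q + r + 1) / M (q + r)) := by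
          have := hM.pos (q + r)
          gcongr
      _ = M (q + (r + 1)) := by
          have := (hM.pos (q + r)).ne'
          field_simp
          rfl

lemma mono (hM : IsWeightSeq M) : Monotone M := by
  refine monotone_nat_of_le_succ fun p => ?_
  have := hM.one_le_ratio (p + 1)
  rw [le_div_iff₀ (hM.pos _)] at this
  simpa using this

lemma assocW_two_mul_le (hM : IsWeightSeq M) (h : M2star M) :
    ∃ (A : ℕ) (C : ℝ), 1 ≤ C ∧ ∀ t, 0 ≤ t → assocW M (2 * t) ≤ C * assocW M t ^ A := by
  obtain ⟨p₀, N, hp₀, hN, h⟩ := h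
  set c : ℝ := M (N * p₀) / (2 ^ (N * p₀) * M (p₀ - 1) ^ N) with hc
  have hMp := hM.pos
  have hc0 : 0 < c := by
    have := hMp (N * p₀); have := hMp (p₀ - 1)
    positivity
  have key : ∀ p, p₀ ≤ p → c * (2 ^ (N * p) * M (p - 1) ^ N) ≤ M (N * p) := by
    intro p hp
    induction p, hp using Nat.le_induction with
    | base =>
      have := hMp (N * p₀); have := hMp (p₀ - 1)
      rw [hc, div_mul_cancel₀ _ (by positivity)]
    | succ p hp ih =>
      have h1 := hM.mul_ratio_pow_le (N * p) N
      have h3 := (hM.pos (p - 1)); have h4 := hMp p; have h5 := hMp (N * p)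
      calc c * (2 ^ (N * (p + 1)) * M (p + 1 - 1) ^ N)
          = c * (2 ^ (N * p) * M (p - 1) ^ N) * (2 * (M p / M (p - 1))) ^ N := by
            rw [Nat.add_sub_cancel, mul_pow, div_pow]
            field_simp
            ring
        _ ≤ M (N * p) * (M (N * p) / M (N * p - 1)) ^ N := by
            gcongr
            exact h p hp
        _ ≤ _ := h1
  set C : ℝ := assocW M 2 + 2 ^ (N * p₀) + c⁻¹ * 2 ^ N * M (2 * N) with hC
  have hW2 := hM.one_le_assocW 2
  have hC1 : (0 : ℝ) ≤ 2 ^ (N * p₀) := by positivity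
  have hC2 : 0 ≤ c⁻¹ * 2 ^ N * M (2 * N) := by have := hMp (2 * N); positivity
  have hCa : assocW M 2 ≤ C := by linarith
  have hCb : 2 ^ (N * p₀) ≤ C := by linarith
  have hCc : c⁻¹ * 2 ^ N * M (2 * N) ≤ C := by linarith
  refine ⟨N + 1, C, hW2.trans hCa, fun t ht => ?_⟩
  have hW := hM.one_le_assocW t
  have hWp := one_le_pow₀ hW (n := N + 1)
  rcases le_total t 1 with ht1 | ht1
  · calc assocW M (2 * t) ≤ assocW M 2 := hM.assocW_mono (by linarith)
      _ ≤ C * 1 := by linarith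
      _ ≤ _ := by gcongr
  · have := hM.assocW_mul_le (t := 2 * t) (y := 1) (D := C * assocW M t ^ (N + 1))
      (by linarith) zero_le_one
    rw [mul_one] at this
    refine this fun q => ?_
    rw [mul_one]
    have hq := hMp q
    rcases lt_or_ge q (N * p₀) with hqN | hqN
    · calc (2 * t) ^ q = 2 ^ q * t ^ q := mul_pow _ _ _
        _ ≤ 2 ^ (N * p₀) * (M q * assocW M t ^ (N + 1)) := by
            gcongr
            · norm_num
            · exact (hM.pow_le ht q).trans (by gcongr; exact le_self_pow₀ hW (by omega))
        _ ≤ C * (M q * assocW M t ^ (N + 1)) := by gcongr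
        _ = _ := by ring
    · set p := q / N with hp
      have hpp : p₀ ≤ p := by rw [hp, Nat.le_div_iff_mul_le hN, mul_comm]; exact hqN
      have hqe : q = N * p + q % N := (Nat.div_add_mod q N).symm
      have hr : q % N < N := Nat.mod_lt _ hN
      set r := q % N
      have hp1 : 1 ≤ p := hp₀.trans_le hpp
      have hMq : M (N * p) ≤ M q := hM.mono (by omega)
      have k := key p hpp
      have e1 : N * p = N * (p - 1) + N := by
        rw [← Nat.mul_succ, Nat.succ_eq_add_one, Nat.sub_add_cancel hp1]
      have hpm := hMp (p - 1); have h2N := hMp (2 * N)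
      calc (2 * t) ^ q = 2 ^ (N * p) * 2 ^ r * ((t ^ (p - 1)) ^ N * t ^ (N + r)) := by
            rw [hqe, mul_pow, ← pow_mul, ← pow_add, ← pow_add]
            congr 2
            rw [mul_comm (p - 1) N]; omega
        _ ≤ 2 ^ (N * p) * 2 ^ N * ((M (p - 1) * assocW M t) ^ N * t ^ (2 * N)) := by
            gcongr
            · norm_num
            · exact hM.pow_le ht _
            · omega
        _ ≤ 2 ^ (N * p) * 2 ^ N * ((M (p - 1) * assocW M t) ^ N * (M (2 * N) * assocW M t)) := by
            gcongr
            exact hM.pow_le ht _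
        _ = (c⁻¹ * 2 ^ N * M (2 * N)) * (c * (2 ^ (N * p) * M (p - 1) ^ N)) * assocW M t ^ (N + 1) := by
            field_simp
            ring
        _ ≤ C * M q * assocW M t ^ (N + 1) := by
            gcongr
            exact k.trans hMq
        _ = _ := by ring

end IsWeightSeq

/-- A nondecreasing function `ω ≥ 1` with `ω(l t) ≤ l ^ K ω(t)` for `l ≥ 1`, `t ≥ 0`. -/
structure Moderate (ω : ℝ → ℝ) (K : ℕ) : Prop where
  mono : Monotone ω
  one_le : ∀ t, 1 ≤ ω t
  dilate : ∀ l t : ℝ, 1 ≤ l → 0 ≤ t → ω (l * t) ≤ l ^ K * ω t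

namespace IsWeightSeq

variable {M : ℕ → ℝ}

lemma log_assocW_nonneg (hM : IsWeightSeq M) (t : ℝ) : 0 ≤ Real.log (assocW M t) :=
  Real.log_nonneg (hM.one_le_assocW t)

lemma log_assocW_mono (hM : IsWeightSeq M) : Monotone fun t => Real.log (assocW M t) :=
  fun _ _ h => Real.log_le_log (hM.assocW_pos _) (hM.assocW_mono h)

lemma nat_mul_log_assocW_le (hM : IsWeightSeq M) (h2 : M2 M) (D : ℕ) :
    ∃ (Q : ℕ) (C : ℝ), 1 ≤ Q ∧ 0 ≤ C ∧ ∀ t, 0 ≤ t →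
      D * Real.log (assocW M t) ≤ Real.log (assocW M (Q * t)) + C := by
  obtain ⟨C₀, H, h2⟩ := h2
  induction D with
  | zero =>
    refine ⟨1, 0, le_rfl, le_rfl, fun t _ => ?_⟩
    simpa using hM.log_assocW_nonneg t
  | succ D ih =>
    obtain ⟨Q, C, hQ, hC, h⟩ := ih
    have hH : H ≤ ⌈H⌉₊ := Nat.le_ceil H
    have hH1 : 1 ≤ ⌈H⌉₊ := Nat.one_le_ceil_iff.2 (by linarith [h2.2.1])
    have hC0 := Real.log_nonneg h2.1
    refine ⟨⌈H⌉₊ * Q, Real.log C₀ + C, Nat.mul_pos hH1 hQ, by linarith, fun t ht => ?_⟩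
    have hQ' : (1 : ℝ) ≤ Q := by exact_mod_cast hQ
    have h1 := h t ht
    have h3 : Real.log (assocW M t) ≤ Real.log (assocW M (Q * t)) :=
      hM.log_assocW_mono (le_mul_of_one_le_left ht hQ')
    have h4 := Real.log_le_log (by have := hM.assocW_pos (Q * t); positivity)
      (hM.assocW_sq_le h2 (t := Q * t) (by positivity))
    rw [Real.log_pow, Real.log_mul (by linarith [h2.1]) (hM.assocW_pos _).ne'] at h4
    have h5 : Real.log (assocW M (H * (Q * t))) ≤ Real.log (assocW M (⌈H⌉₊ * (Q * t))) :=
      hM.log_assocW_mono (by gcongr)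
    push_cast at h4 ⊢
    rw [mul_assoc (⌈H⌉₊ : ℝ)]
    linarith

lemma exists_moderate (hM : IsWeightSeq M) (h : M2star M) :
    ∃ (ω : ℝ → ℝ) (K m : ℕ), Moderate ω K ∧
      ∀ t, ω t ≤ 1 + Real.log (assocW M t) ∧ (0 ≤ t → 1 + Real.log (assocW M t) ≤ 2 ^ m * ω t) := by
  obtain ⟨A, C, hC, hA⟩ := hM.assocW_two_mul_le h
  obtain ⟨K, hK⟩ := pow_unbounded_of_one_lt (1 + Real.log C + A) (one_lt_two (α := ℝ))
  set ν : ℝ → ℝ := fun t => 1 + Real.log (assocW M t) with hν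
  have hν1 : ∀ t, 1 ≤ ν t := fun t => by have := hM.log_assocW_nonneg t; simp only [hν]; linarith
  have hνm : Monotone ν := fun s t hst => by
    have := hM.log_assocW_mono hst
    simp only [hν] at this ⊢; linarith
  have hlogC := Real.log_nonneg hC
  have h2 : ∀ t, 0 ≤ t → ν (2 * t) ≤ 2 ^ K * ν t := fun t ht => by
    have h1 := Real.log_le_log (hM.assocW_pos _) (hA t ht)
    rw [Real.log_mul (by linarith) (pow_ne_zero _ (hM.assocW_pos _).ne'), Real.log_pow] at h1
    have h3 := hM.log_assocW_nonneg t
    calc ν (2 * t) ≤ (1 + Real.log C + A) * ν t := by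
          simp only [hν]
          have : (0 : ℝ) ≤ A := Nat.cast_nonneg _
          nlinarith [mul_nonneg hlogC h3]
      _ ≤ 2 ^ K * ν t := by
          have := hν1 t
          gcongr
  have h2n : ∀ (n : ℕ) t, 0 ≤ t → ν (2 ^ n * t) ≤ (2 ^ n) ^ K * ν t := by
    intro n t ht
    induction n with
    | zero => simp
    | succ n ih =>
      calc ν (2 ^ (n + 1) * t) = ν (2 * (2 ^ n * t)) := by ring_nf
        _ ≤ 2 ^ K * ν (2 ^ n * t) := h2 _ (by positivity)
        _ ≤ 2 ^ K * ((2 ^ n) ^ K * ν t) := by gcongr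
        _ = _ := by ring
  have hl : ∀ l t : ℝ, 1 ≤ l → 0 ≤ t → ν (l * t) ≤ 2 ^ K * (l ^ K * ν t) := by
    intro l t hl ht
    obtain ⟨n, hn1, hn2⟩ := exists_nat_pow_near hl (one_lt_two (α := ℝ))
    have := hν1 t
    calc ν (l * t) ≤ ν (2 ^ (n + 1) * t) := hνm (by gcongr)
      _ ≤ (2 ^ (n + 1)) ^ K * ν t := h2n _ t ht
      _ ≤ (2 * l) ^ K * ν t := by
          gcongr
          rw [pow_succ]; linarith
      _ = _ := by ring
  have hbdd : ∀ t, BddBelow (Set.range fun l : Set.Ici (1 : ℝ) => ν (t / l) * (l : ℝ) ^ K) := by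
    refine fun t => ⟨0, ?_⟩
    rintro _ ⟨⟨l, hl⟩, rfl⟩
    have := hν1 (t / l)
    have : (0 : ℝ) ≤ l := zero_le_one.trans hl
    positivity
  have : Nonempty (Set.Ici (1 : ℝ)) := ⟨⟨1, Set.self_mem_Ici⟩⟩
  refine ⟨fun t => ⨅ l : Set.Ici (1 : ℝ), ν (t / l) * (l : ℝ) ^ K, K, K, ⟨?_, ?_, ?_⟩, ?_⟩
  · intro s t hst
    refine ciInf_mono (hbdd s) fun l => ?_
    have h0 : (0 : ℝ) ≤ l := zero_le_one.trans l.2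
    have := hνm (show s / l ≤ t / l by gcongr)
    gcongr
  · intro t
    refine le_ciInf fun l => ?_
    exact one_le_mul_of_one_le_of_one_le (hν1 _) (one_le_pow₀ l.2)
  · intro l t hl ht
    rw [Real.mul_iInf_of_nonneg (by positivity)]
    refine le_ciInf fun l' => ?_
    have h0 : (0 : ℝ) < l' := zero_lt_one.trans_le l'.2
    refine (ciInf_le (hbdd _) ⟨l * l', one_le_mul_of_one_le_of_one_le hl l'.2⟩).trans_eq ?_
    rw [mul_div_mul_left _ _ (by positivity : l ≠ 0)]
    ring
  · intro t
    constructor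
    · refine (ciInf_le (hbdd t) ⟨1, Set.self_mem_Ici⟩).trans_eq ?_
      simp [hν]
    · intro ht
      rw [Real.mul_iInf_of_nonneg (by positivity)]
      refine le_ciInf fun l => ?_
      have h0 : (0 : ℝ) < l := zero_lt_one.trans_le l.2
      have := hl l (t / l) l.2 (by positivity)
      rw [mul_div_cancel₀ _ h0.ne'] at this
      simp only [hν] at this ⊢
      linarith

lemma exists_moderate_of_dilation (hM : IsWeightSeq M) (h2 : M2 M) (h2s : M2star M) (d : ℕ)
    {h : ℝ} (hh : 0 < h) :
    ∃ (ω : ℝ → ℝ) (K : ℕ) (h' C : ℝ), Moderate ω K ∧ 0 < h' ∧ ∀ t, 0 ≤ t →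
      Real.log (assocW M (h' * t)) ≤ ω (t / (d + 1)) / 2 + C ∧
      2 * d * ω t + Real.log (assocW M (h' * t)) ≤ Real.log (assocW M (h * t)) + C := by
  obtain ⟨ω, K, m, hω, hων⟩ := hM.exists_moderate h2s
  obtain ⟨Q, C, hQ, hC, hD⟩ := hM.nat_mul_log_assocW_le h2 (2 * d + 1)
  obtain ⟨Q', C', hQ', hC', hD'⟩ := hM.nat_mul_log_assocW_le h2 (2 ^ m * 2)
  have hQ0 : (0 : ℝ) < Q := by exact_mod_cast hQ
  have hQ1 : (1 : ℝ) ≤ Q' := by exact_mod_cast hQ'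
  set a : ℝ := h / Q with ha
  have ha0 : 0 < a := by positivity
  refine ⟨fun t => ω (a * t), K, a / (d + 1) / Q', C + C' + 2 * d, ⟨?_, fun t => hω.one_le _, ?_⟩,
    by positivity, fun t ht => ⟨?_, ?_⟩⟩
  · exact fun s t hst => hω.mono (by gcongr)
  · intro l t hl ht
    rw [mul_left_comm]
    exact hω.dilate l _ hl (by positivity)
  · have h1 := hD' (a / (d + 1) / Q' * t) (by positivity)
    have e : Q' * (a / (d + 1) / Q' * t) = a * (t / (d + 1)) := by field_simp
    rw [e] at h1
    have h3 := (hων (a * (t / (d + 1)))).2 (by positivity)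
    push_cast at h1
    have hm : (1 : ℝ) ≤ 2 ^ m := one_le_pow₀ one_le_two
    have h4 : 2 ^ m * (2 * Real.log (assocW M (a / (d + 1) / Q' * t)))
        ≤ 2 ^ m * (ω (a * (t / (d + 1))) + C') := by nlinarith
    have h5 := le_of_mul_le_mul_left h4 (by positivity)
    have : (0 : ℝ) ≤ d := Nat.cast_nonneg _
    linarith
  · have h1 := hD (a * t) (by positivity)
    have e : Q * (a * t) = h * t := by rw [ha]; field_simp
    rw [e] at h1
    have h3 := (hων (a * t)).1
    have h4 : Real.log (assocW M (a / (d + 1) / Q' * t)) ≤ Real.log (assocW M (a * t)) := by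
      refine hM.log_assocW_mono ?_
      gcongr
      rw [div_div]
      refine div_le_self ha0.le ?_
      have : (0 : ℝ) ≤ d := Nat.cast_nonneg _
      nlinarith
    push_cast at h1
    have : (0 : ℝ) ≤ d := Nat.cast_nonneg _
    nlinarith [mul_le_mul_of_nonneg_left h3 (show (0 : ℝ) ≤ 2 * d by positivity)]

lemma exists_moderate_of_family (hM : IsWeightSeq M) (h2 : M2 M) (h2s : M2star M) (d : ℕ)
    (c : ℕ → ℕ → ℝ) :
    ∃ (ω : ℝ → ℝ) (K : ℕ), Moderate ω K ∧
      (∀ h : ℕ, ∃ C, ∀ t, 0 ≤ t → Real.log (assocW M (h * t)) ≤ ω (t / (d + 1)) / 2 + C) ∧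
      ∀ h R : ℕ, ∃ C, ∀ t x, 0 ≤ t → 0 ≤ x → (∀ L : ℕ, x * assocW M (L * t) ≤ c L R) →
        x * Real.exp (2 * d * ω t) * assocW M (h * t) ≤ C := by
  obtain ⟨ω, K, m, hω, hων⟩ := hM.exists_moderate h2s
  obtain ⟨Q, C, hQ, hC, hD⟩ := hM.nat_mul_log_assocW_le h2 (2 * d + 2)
  obtain ⟨Q', C', hQ', hC', hD'⟩ := hM.nat_mul_log_assocW_le h2 (2 ^ m * 2)
  set T : ℕ → ℝ := fun k => k + 1 + ∑ n ∈ Finset.range (k + 1), |c (Q * (k + 3)) n| with hT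
  have hTk : ∀ k : ℕ, (k : ℝ) + 1 ≤ T k := fun k => by
    simp only [hT]
    have : 0 ≤ ∑ n ∈ Finset.range (k + 1), |c (Q * (k + 3)) n| :=
      Finset.sum_nonneg fun _ _ => abs_nonneg _
    linarith
  have hTc : ∀ k n : ℕ, n ≤ k → c (Q * (k + 3)) n ≤ T k := fun k n hn => by
    simp only [hT]
    have := Finset.single_le_sum (f := fun n => |c (Q * (k + 3)) n|) (fun _ _ => abs_nonneg _)
      (Finset.mem_range.2 (Nat.lt_succ_of_le hn))
    have h3 := le_abs_self (c (Q * (k + 3)) n)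
    have : (0 : ℝ) ≤ k := Nat.cast_nonneg _
    linarith
  have hT0 : ∀ k, 0 < T k := fun k => lt_of_lt_of_le (by positivity) (hTk k)
  set r : ℝ → ℝ := fun t => ⨅ k : ℕ, ((k : ℝ) + 1 + max t 0 / T k) with hr
  have hrb : ∀ t, BddBelow (Set.range fun k : ℕ => (k : ℝ) + 1 + max t 0 / T k) := by
    refine fun t => ⟨0, ?_⟩
    rintro _ ⟨k, rfl⟩
    have := hT0 k
    have := le_max_right t 0
    positivity
  have hr1 : ∀ t, 1 ≤ r t := fun t => le_ciInf fun k => by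
    have := hT0 k
    have h3 : 0 ≤ max t 0 / T k := div_nonneg (le_max_right t 0) (hT0 k).le
    have : (0 : ℝ) ≤ k := Nat.cast_nonneg _
    linarith
  have hrm : Monotone r := fun s t hst => ciInf_mono (hrb s) fun k => by
    have := hT0 k
    gcongr
  have hrd : ∀ l t : ℝ, 1 ≤ l → 0 ≤ t → r (l * t) ≤ l * r t := fun l t hl ht => by
    simp only [hr]
    rw [Real.mul_iInf_of_nonneg (by positivity)]
    refine ciInf_mono (hrb _) fun k => ?_
    rw [max_eq_left ht, max_eq_left (by positivity), mul_add, mul_div_assoc]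
    have : (0 : ℝ) ≤ k := Nat.cast_nonneg _
    nlinarith
  have hru : ∀ (k : ℕ) t, 0 ≤ t → t ≤ T k → r t ≤ k + 2 := fun k t h0 ht => by
    refine (ciInf_le (hrb t) k).trans ?_
    have := (div_le_one (hT0 k)).2 ht
    rw [max_eq_left h0]
    linarith
  have hrl : ∀ h : ℕ, ∃ τ : ℝ, 0 ≤ τ ∧ ∀ t, τ ≤ t → h ≤ r t := fun h => by
    refine ⟨∑ k ∈ Finset.range h, h * T k,
      Finset.sum_nonneg fun k _ => mul_nonneg (Nat.cast_nonneg _) (hT0 k).le, fun t ht => ?_⟩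
    refine le_ciInf fun k => ?_
    have h3 : 0 ≤ max t 0 / T k := div_nonneg (le_max_right t 0) (hT0 k).le
    rcases le_or_gt h k with hk | hk
    · have : (h : ℝ) ≤ k := by exact_mod_cast hk
      linarith
    · have h4 := Finset.single_le_sum (f := fun k => h * T k)
        (fun k _ => mul_nonneg (Nat.cast_nonneg h) (hT0 k).le) (Finset.mem_range.2 hk)
      have h5 : (h : ℝ) ≤ max t 0 / T k := by
        rw [le_div_iff₀ (hT0 k)]
        exact (h4.trans ht).trans (le_max_left _ _)
      have : (0 : ℝ) ≤ k := Nat.cast_nonneg _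
      linarith
  set Ω : ℝ → ℝ := fun t => ω (r t * max t 0) with hΩ
  have hΩm : Monotone Ω := fun s t hst => hω.mono (by
    have h1 := hrm hst
    have h3 := hr1 s
    have h4 : max s 0 ≤ max t 0 := max_le_max_right _ hst
    have := le_max_right s 0
    gcongr
    linarith)
  have hΩl : ∀ h : ℕ, ∃ C, ∀ t, 0 ≤ t → ω (h * t) ≤ Ω t + C := fun h => by
    obtain ⟨τ, hτ0, hτ⟩ := hrl h
    refine ⟨ω (h * τ), fun t ht => ?_⟩
    have h3 := hω.one_le (h * τ)
    have h4 := hω.one_le (r t * max t 0)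
    simp only [hΩ]
    rcases le_total τ t with h5 | h5
    · have : ω (h * t) ≤ ω (r t * max t 0) := hω.mono (by
        rw [max_eq_left ht]
        have := hτ t h5
        gcongr)
      linarith
    · have : ω (h * t) ≤ ω (h * τ) := hω.mono (by gcongr)
      linarith
  refine ⟨Ω, K + K, ⟨hΩm, fun t => hω.one_le _, ?_⟩, ?_, ?_⟩
  · intro l t hl ht
    simp only [hΩ]
    rw [max_eq_left ht, max_eq_left (by positivity), pow_add, ← mul_pow]
    have h3 := hr1 t
    refine (hω.mono ?_).trans (hω.dilate (l * l) (r t * t) (by nlinarith) (by positivity))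
    calc r (l * t) * (l * t) ≤ (l * r t) * (l * t) := by
          have := hrd l t hl ht
          gcongr
      _ = _ := by ring
  · intro h
    obtain ⟨C₃, hC₃⟩ := hΩl (Q' * h * (d + 1))
    refine ⟨(C₃ + C') / 2, fun t ht => ?_⟩
    have h1 := hD' (h * t) (by positivity)
    have h3 := (hων (Q' * (h * t))).2 (by positivity)
    have h4 := hC₃ (t / (d + 1)) (by positivity)
    have e : ((Q' * h * (d + 1) : ℕ) : ℝ) * (t / (d + 1)) = Q' * (h * t) := by
      push_cast; field_simp
    rw [e] at h4
    push_cast at h1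
    have hm : (1 : ℝ) ≤ 2 ^ m := one_le_pow₀ one_le_two
    have h5 : 2 ^ m * (2 * Real.log (assocW M (h * t)))
        ≤ 2 ^ m * (ω (Q' * (h * t)) + C') := by nlinarith
    have h6 := le_of_mul_le_mul_left h5 (by positivity)
    linarith
  · intro h R
    set k₀ := R + h with hk₀
    refine ⟨max (|c 0 R| * Real.exp (2 * d * Ω (T k₀)) * assocW M (h * T k₀))
      (Real.exp (2 * d + C)), fun t x ht hx hL => ?_⟩
    rcases le_or_gt t (T k₀) with htk | htk
    · refine le_max_of_le_left ?_
      have h3 := hL 0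
      have h4 : x ≤ |c 0 R| := by
        have := hM.one_le_assocW (((0 : ℕ) : ℝ) * t)
        have h5 : x ≤ x * assocW M (((0 : ℕ) : ℝ) * t) := le_mul_of_one_le_right hx this
        exact (h5.trans h3).trans (le_abs_self _)
      have h5 := hΩm htk
      have h6 := hM.assocW_mono (show h * t ≤ h * T k₀ by gcongr)
      have := hM.assocW_pos (h * t)
      gcongr
    · refine le_max_of_le_right ?_
      have hex : ∃ j, k₀ ≤ j ∧ t ≤ T j := by
        refine ⟨max k₀ ⌈t⌉₊, le_max_left _ _, (Nat.le_ceil t).trans (le_trans ?_ (hTk _))⟩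
        have : (⌈t⌉₊ : ℝ) ≤ (max k₀ ⌈t⌉₊ : ℕ) := by exact_mod_cast le_max_right _ _
        linarith
      classical
      obtain ⟨hj1, hj2⟩ := Nat.find_spec hex
      have hjne : Nat.find hex ≠ k₀ := fun h => by rw [h] at hj2; linarith
      obtain ⟨k, hk⟩ : ∃ k, Nat.find hex = k + 1 := ⟨Nat.find hex - 1, by omega⟩
      have hkk : k₀ ≤ k := by omega
      have hTt : T k < t := by
        have := Nat.find_min hex (m := k) (by omega)
        push Not at this
        exact this hkk
      rw [hk] at hj2
      have hrt := hru (k + 1) t ht hj2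
      have h3 := hL (Q * (k + 3))
      have h4 : Ω t ≤ 1 + Real.log (assocW M ((k + 3) * t)) := by
        refine (hων _).1.trans ?_
        have := hM.log_assocW_mono (show r t * max t 0 ≤ (k + 3) * t by
          rw [max_eq_left ht]; gcongr; push_cast at hrt; linarith)
        simp only at this
        linarith
      have h5 := hD ((k + 3) * t) (by positivity)
      have h6 : Real.log (assocW M (h * t)) ≤ Real.log (assocW M ((k + 3) * t)) :=
        hM.log_assocW_mono (by
          have : (h : ℝ) ≤ k := by exact_mod_cast (show h ≤ k by omega)
          gcongr; linarith)
      have h7 : c (Q * (k + 3)) R ≤ assocW M ((k + 3) * t) := by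
        have h8 := hM.pow_le (show (0 : ℝ) ≤ (k + 3) * t by positivity) 1
        rw [pow_one, hM.2.2.1, one_mul] at h8
        refine ((hTc k R (by omega)).trans hTt.le).trans (le_trans ?_ h8)
        have : (0 : ℝ) ≤ k := Nat.cast_nonneg _
        nlinarith
      have h9 : Real.exp (2 * d * Ω t) * assocW M (h * t) * assocW M ((k + 3) * t)
          ≤ Real.exp (2 * d + C) * assocW M ((Q * (k + 3) : ℕ) * t) := by
        rw [← Real.exp_log (hM.assocW_pos (h * t)), ← Real.exp_log (hM.assocW_pos ((k + 3) * t)),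
          ← Real.exp_log (hM.assocW_pos ((Q * (k + 3) : ℕ) * t)), ← Real.exp_add, ← Real.exp_add,
          ← Real.exp_add]
        refine Real.exp_le_exp.2 ?_
        have e : (Q : ℝ) * ((k + 3) * t) = ((Q * (k + 3) : ℕ) : ℝ) * t := by push_cast; ring
        rw [e] at h5
        push_cast at h5 ⊢
        have : (0 : ℝ) ≤ d := Nat.cast_nonneg _
        nlinarith [mul_le_mul_of_nonneg_left h4 (show (0 : ℝ) ≤ 2 * d by positivity)]
      have hpos := hM.assocW_pos ((k + 3) * t)
      refine le_of_mul_le_mul_right ?_ hpos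
      calc x * Real.exp (2 * d * Ω t) * assocW M (h * t) * assocW M ((k + 3) * t)
          = x * (Real.exp (2 * d * Ω t) * assocW M (h * t) * assocW M ((k + 3) * t)) := by ring
        _ ≤ x * (Real.exp (2 * d + C) * assocW M ((Q * (k + 3) : ℕ) * t)) := by gcongr
        _ = Real.exp (2 * d + C) * (x * assocW M ((Q * (k + 3) : ℕ) * t)) := by ring
        _ ≤ Real.exp (2 * d + C) * assocW M ((k + 3) * t) := by
            gcongr; exact h3.trans h7

end IsWeightSeq

lemma differentiable_integral_of_dominated {α : Type*} [MeasurableSpace α] {μ : Measure α}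
    {F : ℂ → α → ℂ} (hmeas : ∀ z, AEStronglyMeasurable (F z) μ)
    (hdiff : ∀ a, Differentiable ℂ fun z => F z a)
    (hbound : ∀ R : ℝ, ∃ b : α → ℝ, Integrable b μ ∧ ∀ z, ‖z‖ ≤ R → ∀ a, ‖F z a‖ ≤ b a) :
    Differentiable ℂ fun z => ∫ a, F z a ∂μ := by
  intro z₀
  obtain ⟨b, hb, hFb⟩ := hbound (‖z₀‖ + 2)
  have hder : ∀ a z, z ∈ Metric.ball z₀ 1 → ‖deriv (fun z => F z a) z‖ ≤ b a := by
    intro a z hz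
    have h1 := Complex.norm_deriv_le_of_forall_mem_sphere_norm_le (c := z) (R := 1) (C := b a)
      (f := fun z => F z a) one_pos (hdiff a).diffContOnCl (fun w hw => hFb w ?_ a)
    · simpa using h1
    · rw [mem_sphere_iff_norm] at hw
      rw [mem_ball_iff_norm] at hz
      calc ‖w‖ = ‖(w - z) + (z - z₀) + z₀‖ := by congr 1; ring
        _ ≤ ‖w - z‖ + ‖z - z₀‖ + ‖z₀‖ := norm_add₃_le
        _ ≤ ‖z₀‖ + 2 := by linarith
  have hmeas' : AEStronglyMeasurable (fun a => deriv (fun z => F z a) z₀) μ := by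
    have hlim : Tendsto (fun n : ℕ => z₀ + ((n : ℂ) + 1)⁻¹) atTop (nhdsWithin z₀ {z₀}ᶜ) := by
      refine tendsto_nhdsWithin_iff.2 ⟨?_, Eventually.of_forall fun n => ?_⟩
      · have := tendsto_one_div_add_atTop_nhds_zero_nat (𝕜 := ℂ)
        simpa using this.const_add z₀
      · simpa using Nat.cast_add_one_ne_zero (R := ℂ) n
    refine aestronglyMeasurable_of_tendsto_ae atTop
      (f := fun (n : ℕ) a => slope (fun z => F z a) z₀ (z₀ + ((n : ℂ) + 1)⁻¹)) (fun n => ?_)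
      (Eventually.of_forall fun a => ?_)
    · simp only [slope, vsub_eq_sub]
      exact ((hmeas _).sub (hmeas _)).const_smul (_ : ℂ)
    · exact ((hasDerivAt_iff_tendsto_slope.1 ((hdiff a) z₀).hasDerivAt)).comp hlim
  refine (hasDerivAt_integral_of_dominated_loc_of_deriv_le (Metric.ball_mem_nhds z₀ one_pos)
    (Eventually.of_forall hmeas) ?_ (F' := fun z a => deriv (fun z => F z a) z) hmeas'
    (Eventually.of_forall hder) hb
    (Eventually.of_forall fun a z _ => ((hdiff a) z).hasDerivAt)).2.differentiableAt
  exact hb.mono' (hmeas z₀) (Eventually.of_forall fun a => hFb z₀ (by linarith) a)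

lemma one_add_pow_le (K : ℕ) {u : ℝ} (hu : 0 ≤ u) : (1 + u) ^ K ≤ 1 + K * u * (1 + u) ^ K := by
  induction K with
  | zero => simp
  | succ K ih =>
    have h1 : (1 : ℝ) ≤ (1 + u) ^ (K + 1) := one_le_pow₀ (by linarith)
    calc (1 + u) ^ (K + 1) = (1 + u) * (1 + u) ^ K := by ring
      _ ≤ (1 + u) * (1 + K * u * (1 + u) ^ K) := by gcongr
      _ = 1 + u * 1 + K * u * (1 + u) ^ (K + 1) := by ring
      _ ≤ 1 + u * (1 + u) ^ (K + 1) + K * u * (1 + u) ^ (K + 1) := by gcongr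
      _ = _ := by push_cast; ring

lemma one_add_abs_pow_le (K : ℕ) (t : ℝ) :
    (1 + |t|) ^ K ≤ K.factorial * Real.exp 2 * Real.exp (t ^ 2 / 4) := by
  have h1 := Real.pow_div_factorial_le_exp (1 + |t|) (by positivity) K
  rw [div_le_iff₀ (by positivity)] at h1
  have h2 : Real.exp (1 + |t|) ≤ Real.exp 2 * Real.exp (t ^ 2 / 4) := by
    rw [← Real.exp_add]
    refine Real.exp_le_exp.2 ?_
    nlinarith [sq_nonneg (|t| / 2 - 1), sq_abs t]
  have : (0 : ℝ) ≤ K.factorial := by positivity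
  nlinarith

namespace Moderate

variable {ω : ℝ → ℝ} {K : ℕ}

lemma measurable_comp_abs (hω : Moderate ω K) : Measurable fun t => ω |t| :=
  hω.mono.measurable.comp continuous_abs.measurable

lemma le_one_add_abs (hω : Moderate ω K) {a t : ℝ} (ha : 0 ≤ a) :
    ω (a * (1 + |t|)) ≤ ω a * (1 + |t|) ^ K := by
  rw [mul_comm, mul_comm (ω a)]
  exact hω.dilate _ _ (by linarith [abs_nonneg t]) ha

lemma abs_sub_le_of_le (hω : Moderate ω K) {a₀ : ℝ} (ha₀ : 1 ≤ a₀) {x t : ℝ} (hx : |x| ≤ a₀) :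
    |ω (|x - t|) - ω (|x|)| ≤ ω a₀ * (1 + |t|) ^ K := by
  have h1 : |x - t| ≤ a₀ * (1 + |t|) := by
    have := abs_sub x t
    nlinarith [abs_nonneg t]
  have h2 : |x| ≤ a₀ * (1 + |t|) := by nlinarith [abs_nonneg t]
  have h3 := hω.le_one_add_abs (t := t) (zero_le_one.trans ha₀)
  have h4 := hω.mono h1
  have h5 := hω.mono h2
  have h6 := hω.one_le |x - t|
  have h7 := hω.one_le |x|
  rw [abs_sub_le_iff]
  constructor <;> linarith

lemma abs_sub_le_div (hω : Moderate ω K) {x t : ℝ} (hx : 1 ≤ |x|) :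
    |ω (|x - t|) - ω (|x|)| ≤ ω |x| / |x| * ((K + 1) * (1 + |t|) ^ (K + 1)) := by
  set a := |x| with ha
  set b := |x - t| with hb
  have ha0 : 0 < a := by linarith
  have hωa := hω.one_le a
  have hωb := hω.one_le b
  have hb0 : 0 ≤ b := abs_nonneg _
  have h1 : b ≤ a + |t| := abs_sub x t
  have h2 : a ≤ b + |t| := by
    have := abs_add_le (x - t) t
    rwa [sub_add_cancel] at this
  have ht := abs_nonneg t
  have hp : (1 : ℝ) ≤ (1 + |t|) ^ K := one_le_pow₀ (by linarith)
  have hK : (0 : ℝ) ≤ K := Nat.cast_nonneg _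
  rw [abs_sub_le_iff]
  constructor
  · have h3 : ω b ≤ (1 + |t| / a) ^ K * ω a := by
      refine (hω.mono ?_).trans (hω.dilate (1 + |t| / a) a ?_ ha0.le)
      · rw [add_mul, div_mul_cancel₀ _ ha0.ne', one_mul]; exact h1
      · have : 0 ≤ |t| / a := by positivity
        linarith
    have h4 := one_add_pow_le K (show 0 ≤ |t| / a by positivity)
    have h5 : |t| / a ≤ |t| := div_le_self ht hx
    have h6 : (1 + |t| / a) ^ K ≤ (1 + |t|) ^ K := by gcongr
    calc ω b - ω a ≤ (1 + K * (|t| / a) * (1 + |t| / a) ^ K) * ω a - ω a := by gcongr; exact h3.trans (by gcongr)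
      _ = ω a / a * (K * (|t| * (1 + |t| / a) ^ K)) := by field_simp; ring
      _ ≤ ω a / a * ((K + 1) * ((1 + |t|) * (1 + |t|) ^ K)) := by
          gcongr <;> linarith
      _ = _ := by ring
  · have h3 : ω a - ω b ≤ ω a / a * ((K + 1) * |t|) := by
      rcases hb0.eq_or_lt with h0 | h0
      · rw [← h0, zero_add] at h2
        calc ω a - ω b ≤ ω a / a * (1 * a) := by field_simp; linarith
          _ ≤ _ := by gcongr; linarith
      · rcases le_total a b with hab | hab
        · have := hω.mono hab
          have h4 : 0 ≤ ω a / a * ((K + 1) * |t|) := by positivity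
          linarith
        · have h4 : ω a ≤ (a / b) ^ K * ω b := by
            have := hω.dilate (a / b) b ((one_le_div h0).2 hab) hb0
            rwa [div_mul_cancel₀ _ h0.ne'] at this
          have h5 : (b / a) ^ K * ω a ≤ ω b := by
            calc (b / a) ^ K * ω a ≤ (b / a) ^ K * ((a / b) ^ K * ω b) := by gcongr
              _ = ω b := by
                rw [← mul_assoc, ← mul_pow, div_mul_div_cancel₀ ha0.ne', div_self h0.ne', one_pow,
                  one_mul]
          have h6 : 1 + (K : ℝ) * (b / a - 1) ≤ (b / a) ^ K := by
            have := one_add_mul_le_pow (a := b / a - 1) (by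
              have : 0 ≤ b / a := by positivity
              linarith) K
            simpa using this
          have h7 : (1 + (K : ℝ) * (b / a - 1)) * ω a ≤ ω b := le_trans (by gcongr) h5
          have h8 : 1 - b / a ≤ |t| / a := by
            rw [one_sub_div ha0.ne']; gcongr; linarith
          calc ω a - ω b ≤ ω a * (K * (1 - b / a)) := by linarith
            _ ≤ ω a * (K * (|t| / a)) := by gcongr
            _ = ω a / a * (K * |t|) := by ring
            _ ≤ _ := by gcongr; linarith
    refine h3.trans ?_
    gcongr
    rw [pow_succ]
    nlinarith

end Moderate

/-- The convolution of `t ↦ ω |t|` with the Gaussian `π^{-1/2} exp(-t²)`. -/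
def gaussSmooth (ω : ℝ → ℝ) (z : ℂ) : ℂ :=
  (Real.sqrt Real.pi : ℂ)⁻¹ * ∫ t : ℝ, (ω |t| : ℂ) * Complex.exp (-(z - t) ^ 2)

lemma norm_cexp_neg_sq (z : ℂ) : ‖Complex.exp (-z ^ 2)‖ = Real.exp (z.im ^ 2 - z.re ^ 2) := by
  rw [Complex.norm_exp]
  congr 1
  simp [sq, Complex.mul_re]

lemma integrable_moderate_pow (K : ℕ) :
    Integrable fun t : ℝ => (1 + |t|) ^ K * Real.exp (-(t ^ 2 / 2)) := by
  have h := (integrable_exp_neg_mul_sq (b := 1 / 4) (by norm_num)).const_mul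
    (K.factorial * Real.exp 2)
  refine h.mono' (by fun_prop) (Eventually.of_forall fun t => ?_)
  rw [Real.norm_of_nonneg (by positivity)]
  calc (1 + |t|) ^ K * Real.exp (-(t ^ 2 / 2))
      ≤ (K.factorial * Real.exp 2 * Real.exp (t ^ 2 / 4)) * Real.exp (-(t ^ 2 / 2)) := by
        gcongr; exact one_add_abs_pow_le K t
    _ = _ := by
        rw [mul_assoc, ← Real.exp_add]
        congr 2; ring

namespace Moderate

variable {ω : ℝ → ℝ} {K : ℕ}

lemma differentiable_gaussSmooth (hω : Moderate ω K) : Differentiable ℂ (gaussSmooth ω) := by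
  unfold gaussSmooth
  refine Differentiable.const_mul (differentiable_integral_of_dominated (fun z => ?_) (fun t => ?_)
    fun R => ?_) _
  · exact ((Complex.measurable_ofReal.comp hω.measurable_comp_abs).mul
      (by fun_prop : Measurable fun t : ℝ => Complex.exp (-(z - t) ^ 2))).aestronglyMeasurable
  · fun_prop
  · refine ⟨fun t => ω 1 * Real.exp (2 * R ^ 2) * ((1 + |t|) ^ K * Real.exp (-(t ^ 2 / 2))),
      (integrable_moderate_pow K).const_mul _, fun z hz t => ?_⟩
    have h1 := hω.le_one_add_abs (a := 1) (t := t) zero_le_one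
    have h2 : ω |t| ≤ ω 1 * (1 + |t|) ^ K := by
      refine (hω.mono ?_).trans h1
      linarith
    have h3 := hω.one_le |t|
    have h4 := hω.one_le 1
    rw [norm_mul, Complex.norm_real, Real.norm_of_nonneg (by linarith), norm_cexp_neg_sq]
    have h5 : (z - t).im ^ 2 - (z - t).re ^ 2 ≤ 2 * R ^ 2 + -(t ^ 2 / 2) := by
      have h6 := Complex.sq_norm z
      rw [Complex.normSq_apply] at h6
      have h7 : ‖z‖ ^ 2 ≤ R ^ 2 := by gcongr
      simp only [Complex.sub_im, Complex.ofReal_im, Complex.sub_re, Complex.ofReal_re, sub_zero]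
      nlinarith [sq_nonneg (2 * z.re - t), sq_nonneg z.im, sq_nonneg z.re]
    calc ω |t| * Real.exp ((z - t).im ^ 2 - (z - t).re ^ 2)
        ≤ (ω 1 * (1 + |t|) ^ K) * Real.exp (2 * R ^ 2 + -(t ^ 2 / 2)) := by gcongr
      _ = _ := by rw [Real.exp_add]; ring

lemma norm_gaussSmooth_sub_le (hω : Moderate ω K) (R : ℝ) :
    ∃ C, ∀ x y : ℝ, |y| ≤ R → ‖gaussSmooth ω (x + y * Complex.I) - ω |x|‖ ≤ ω |x| / 2 + C := by
  set P : ℝ → ℝ := fun t => (K + 1) * (1 + |t|) ^ (K + 1) with hP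
  set S : ℝ := (Real.sqrt Real.pi)⁻¹ * ∫ t : ℝ, P t * Real.exp (R ^ 2 - t ^ 2) with hS
  have hPi : Integrable fun t : ℝ => P t * Real.exp (R ^ 2 - t ^ 2) := by
    refine ((integrable_moderate_pow (K + 1)).const_mul ((K + 1) * Real.exp (R ^ 2))).mono'
      (by fun_prop) (Eventually.of_forall fun t => ?_)
    have hp : 0 ≤ P t := by positivity
    rw [Real.norm_of_nonneg (by positivity)]
    calc P t * Real.exp (R ^ 2 - t ^ 2) ≤ P t * Real.exp (R ^ 2 + -(t ^ 2 / 2)) := by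
          gcongr; nlinarith [sq_nonneg t]
      _ = _ := by rw [Real.exp_add]; ring
  have key : ∀ x y A : ℝ, |y| ≤ R → (∀ t, |ω (|x - t|) - ω (|x|)| ≤ A * P t) →
      ‖gaussSmooth ω (x + y * Complex.I) - ω |x|‖ ≤ A * S := by
    intro x y A hy hA
    have hyR : y ^ 2 ≤ R ^ 2 := by rw [← sq_abs y]; gcongr
    have hA0 : ∀ t, 0 ≤ A * P t := fun t => (abs_nonneg _).trans (hA t)
    have hgauss := GaussianFourier.integral_cexp_neg_mul_sq_add_real_mul_I (b := 1) (by simp) y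
    have hgi := GaussianFourier.integrable_cexp_neg_mul_sq_add_real_mul_I (b := 1) (by simp) y
    simp only [neg_mul, one_mul, div_one] at hgauss hgi
    have hpi : ((Real.pi : ℂ) ^ (1 / 2 : ℂ)) = (Real.sqrt Real.pi : ℂ) := by
      rw [Real.sqrt_eq_rpow, Complex.ofReal_cpow Real.pi_pos.le]; simp
    rw [hpi] at hgauss
    have hs0 : (Real.sqrt Real.pi : ℂ) ≠ 0 := by
      have := Real.sqrt_pos.2 Real.pi_pos
      exact_mod_cast this.ne'
    have hbd : ∀ t : ℝ, ‖((ω |x - t| : ℂ) - ω |x|) * Complex.exp (-(t + y * Complex.I) ^ 2)‖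
        ≤ A * (P t * Real.exp (R ^ 2 - t ^ 2)) := by
      intro t
      rw [norm_mul, norm_cexp_neg_sq, ← mul_assoc, ← Complex.ofReal_sub, Complex.norm_real,
        Real.norm_eq_abs]
      have := hA0 t
      refine mul_le_mul (hA t) (Real.exp_le_exp.2 ?_) (Real.exp_pos _).le this
      simpa using hyR
    have hmeas : AEStronglyMeasurable (fun t : ℝ => ((ω |x - t| : ℂ) - ω |x|) *
        Complex.exp (-(t + y * Complex.I) ^ 2)) := by
      have h1 : Measurable fun t : ℝ => ω |x - t| :=
        hω.measurable_comp_abs.comp (measurable_const.sub measurable_id)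
      exact (((Complex.measurable_ofReal.comp h1).sub measurable_const).mul
        (by fun_prop : Measurable fun t : ℝ =>
          Complex.exp (-(t + y * Complex.I) ^ 2))).aestronglyMeasurable
    have hint := (hPi.const_mul A).mono' hmeas (Eventually.of_forall hbd)
    have e1 : gaussSmooth ω (x + y * Complex.I) - ω |x| = (Real.sqrt Real.pi : ℂ)⁻¹ *
        ∫ t : ℝ, ((ω |x - t| : ℂ) - ω |x|) * Complex.exp (-(t + y * Complex.I) ^ 2) := by
      have e2 : (ω |x| : ℂ) = (Real.sqrt Real.pi : ℂ)⁻¹ *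
          ∫ t : ℝ, (ω |x| : ℂ) * Complex.exp (-(t + y * Complex.I) ^ 2) := by
        rw [integral_const_mul, hgauss]
        field_simp
      have e3 : gaussSmooth ω (x + y * Complex.I) = (Real.sqrt Real.pi : ℂ)⁻¹ *
          ∫ t : ℝ, (ω |x - t| : ℂ) * Complex.exp (-(t + y * Complex.I) ^ 2) := by
        unfold gaussSmooth
        congr 1
        rw [← integral_sub_left_eq_self _ volume x]
        refine integral_congr_ae (Eventually.of_forall fun t => ?_)
        simp only
        congr 3
        push_cast
        ring
      rw [e3]
      conv_lhs => rw [e2]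
      rw [← mul_sub, ← integral_sub]
      · congr 2
        ext t
        rw [sub_mul]
      · have := hint.add (hgi.const_mul (ω |x| : ℂ))
        refine this.congr (Eventually.of_forall fun t => ?_)
        simp only [Pi.add_apply]
        ring
      · exact hgi.const_mul _
    rw [e1, norm_mul, norm_inv, Complex.norm_real, Real.norm_of_nonneg (Real.sqrt_nonneg _), hS,
      mul_left_comm, ← integral_const_mul]
    gcongr
    exact norm_integral_le_of_norm_le (hPi.const_mul A) (Eventually.of_forall hbd)
  have hS0 : 0 ≤ S := by
    refine mul_nonneg (by positivity) (integral_nonneg fun t => ?_)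
    have : 0 ≤ P t := by positivity
    positivity
  set a₀ : ℝ := max 1 (2 * S) with ha₀
  refine ⟨ω a₀ * S, fun x y hy => ?_⟩
  have h1 := hω.one_le a₀
  have h2 := hω.one_le |x|
  rcases le_total |x| a₀ with hx | hx
  · refine (key x y (ω a₀) hy fun t => (hω.abs_sub_le_of_le (le_max_left _ _) hx).trans ?_).trans
      (by linarith)
    gcongr
    simp only [hP]
    have h3 : (1 + |t|) ^ K ≤ (1 + |t|) ^ (K + 1) :=
      pow_le_pow_right₀ (by linarith [abs_nonneg t]) (Nat.le_succ K)
    have : (0 : ℝ) ≤ K * (1 + |t|) ^ (K + 1) := by positivity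
    linarith
  · have hx1 : 1 ≤ |x| := (le_max_left _ _).trans hx
    have hx2 : 2 * S ≤ |x| := (le_max_right _ _).trans hx
    refine (key x y (ω |x| / |x|) hy fun t => hω.abs_sub_le_div hx1).trans ?_
    have : ω |x| / |x| * S ≤ ω |x| / 2 := by
      rw [div_mul_eq_mul_div, div_le_div_iff₀ (by linarith) two_pos]
      nlinarith
    have : 0 ≤ ω a₀ * S := by positivity
    linarith

end Moderate

/-- The point `ξ + iη` of `ℂ^d`. -/
def toC {d : ℕ} (ξ η : Rd d) : Fin d → ℂ := fun k => (ξ k : ℂ) + (η k : ℂ) * Complex.I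

/-- The bound `|g(ξ + iη)| ≤ C / sup_p (h|ξ|)^p / M_p` on the tube `|η| ≤ R`. -/
def StripBd {d : ℕ} (M : ℕ → ℝ) (h R C : ℝ) (g : (Fin d → ℂ) → ℂ) : Prop :=
  ∀ ξ η : Rd d, ‖η‖ ≤ R → ‖g (toC ξ η)‖ * assocW M (h * ‖ξ‖) ≤ C

lemma abs_coord_le {d : ℕ} (ξ : Rd d) (k : Fin d) : |ξ k| ≤ ‖ξ‖ := PiLp.norm_apply_le ξ k

lemma norm_eq_zero_or_exists_coord {d : ℕ} (ξ : Rd d) :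
    ‖ξ‖ = 0 ∨ ∃ k, ‖ξ‖ / (d + 1) ≤ |ξ k| := by
  by_contra! h
  obtain ⟨h0, h1⟩ := h
  have hpos : 0 < ‖ξ‖ := lt_of_le_of_ne (norm_nonneg _) (Ne.symm h0)
  have h2 : ‖ξ‖ ≤ ∑ k, |ξ k| := by
    rw [EuclideanSpace.norm_eq]
    refine Real.sqrt_le_left (Finset.sum_nonneg fun k _ => abs_nonneg _) |>.2 ?_
    simpa using Finset.sum_sq_le_sq_sum_of_nonneg (s := Finset.univ) (f := fun k => |ξ k|)
      fun k _ => abs_nonneg _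
  have h3 : ∑ k, |ξ k| ≤ d * (‖ξ‖ / (d + 1)) := by
    refine (Finset.sum_le_card_nsmul _ _ _ fun k _ => (h1 k).le).trans ?_
    simp
  have h4 : d * (‖ξ‖ / (d + 1)) < ‖ξ‖ := by
    rw [← mul_div_assoc, div_lt_iff₀ (by positivity)]
    nlinarith
  linarith

/-- The entire function `ζ ↦ exp (∑ₖ (ω ∗ Gaussian)(ζₖ))`. -/
def expFactor (d : ℕ) (ω : ℝ → ℝ) (ζ : Fin d → ℂ) : ℂ := Complex.exp (∑ k, gaussSmooth ω (ζ k))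

namespace Moderate

variable {ω : ℝ → ℝ} {K : ℕ}

lemma differentiable_expFactor (hω : Moderate ω K) (d : ℕ) :
    Differentiable ℂ (expFactor d ω) := by
  have := hω.differentiable_gaussSmooth
  unfold expFactor
  fun_prop

lemma norm_expFactor_le (hω : Moderate ω K) (d : ℕ) (R : ℝ) :
    ∃ C, ∀ ξ η : Rd d, ‖η‖ ≤ R →
      ‖expFactor d ω (toC ξ η)‖ ≤ Real.exp (C + 2 * d * ω ‖ξ‖) ∧
      ‖(expFactor d ω (toC ξ η))⁻¹‖ ≤ Real.exp (C - ω (‖ξ‖ / (d + 1)) / 2) := by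
  obtain ⟨C, hC⟩ := hω.norm_gaussSmooth_sub_le R
  have hre : ∀ ξ η : Rd d, ‖η‖ ≤ R → ∀ k,
      |(gaussSmooth ω (toC ξ η k)).re - ω (|ξ k|)| ≤ ω |ξ k| / 2 + C := by
    intro ξ η hη k
    refine le_trans ?_ (hC (ξ k) (η k) ((abs_coord_le η k).trans hη))
    rw [← Complex.ofReal_re (ω |ξ k|), ← Complex.sub_re]
    exact Complex.abs_re_le_norm _
  refine ⟨d * C + ω 0 + d * |C|, fun ξ η hη => ?_⟩
  have h0 := hω.one_le 0
  have hdC : 0 ≤ d * |C| := by positivity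
  rw [norm_inv, expFactor, Complex.norm_exp, Complex.re_sum, ← Real.exp_neg]
  constructor
  · refine Real.exp_le_exp.2 ?_
    have h1 : ∑ k, (gaussSmooth ω (toC ξ η k)).re ≤ d * (3 / 2 * ω ‖ξ‖ + C) := by
      refine (Finset.sum_le_card_nsmul _ _ (3 / 2 * ω ‖ξ‖ + C) fun k _ => ?_).trans (by simp [mul_add])
      have := (abs_le.1 (hre ξ η hη k)).2
      have := hω.mono (abs_coord_le ξ k)
      linarith
    have h2 : 0 ≤ d * ω ‖ξ‖ := mul_nonneg (by positivity) (by linarith [hω.one_le ‖ξ‖])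
    linarith
  · refine Real.exp_le_exp.2 ?_
    have h1 : ∑ k, (ω |ξ k| / 2 - C) ≤ ∑ k, (gaussSmooth ω (toC ξ η k)).re := by
      refine Finset.sum_le_sum fun k _ => ?_
      have := (abs_le.1 (hre ξ η hη k)).1
      linarith
    rw [Finset.sum_sub_distrib] at h1
    simp only [Finset.sum_const, Finset.card_univ, Fintype.card_fin, nsmul_eq_mul] at h1
    have hnn : ∀ k ∈ Finset.univ, 0 ≤ ω |ξ k| / 2 := fun k _ => by linarith [hω.one_le |ξ k|]
    rcases norm_eq_zero_or_exists_coord ξ with h | ⟨k, hk⟩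
    · have := Finset.sum_nonneg hnn
      rw [h, zero_div]
      linarith
    · have := Finset.single_le_sum hnn (Finset.mem_univ k)
      have := hω.mono hk
      linarith

end Moderate

lemma toC_add_smul {d : ℕ} (ξ η : Rd d) (z : ℂ) :
    (fun k => (ξ k : ℂ) + z * (η k : ℂ)) = toC (ξ + z.re • η) (z.im • η) := by
  funext k
  simp only [toC, PiLp.add_apply, PiLp.smul_apply, smul_eq_mul]
  push_cast
  linear_combination (η k : ℂ) * (Complex.re_add_im z).symm

lemma continuous_toC_left {d : ℕ} (η : Rd d) : Continuous fun ξ : Rd d => toC ξ η := by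
  unfold toC
  fun_prop

lemma continuous_toC_smul {d : ℕ} (η : Rd d) (z : ℂ) :
    Continuous fun ξ : Rd d => fun k => (ξ k : ℂ) + z * (η k : ℂ) := by
  fun_prop

lemma integrable_one_add_norm_inv_pow (d : ℕ) :
    Integrable fun ξ : Rd d => ((1 + ‖ξ‖) ^ (d + 1))⁻¹ := by
  have := integrable_one_add_norm (E := Rd d) (μ := volume) (r := (d : ℝ) + 1) (by simp)
  refine this.congr (Eventually.of_forall fun ξ => ?_)
  have : (0 : ℝ) ≤ 1 + ‖ξ‖ := by positivity
  simp only
  rw [Real.rpow_neg this]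
  congr 1
  exact_mod_cast Real.rpow_natCast (1 + ‖ξ‖) (d + 1)

/-- Shifting the contour of integration of a holomorphic function from `ℝ^d` to `ℝ^d + iη`. -/
lemma integral_toC_eq {d : ℕ} {g : (Fin d → ℂ) → ℂ} (hg : Differentiable ℂ g)
    (hb : ∀ R : ℝ, ∃ C, ∀ ξ η : Rd d, ‖η‖ ≤ R → ‖g (toC ξ η)‖ * (1 + ‖ξ‖) ^ (d + 1) ≤ C)
    (η : Rd d) : ∫ ξ : Rd d, g (toC ξ η) = ∫ ξ : Rd d, g (toC ξ 0) := by
  set Φ : ℂ → ℂ := fun z => ∫ ξ : Rd d, g fun k => (ξ k : ℂ) + z * (η k : ℂ) with hΦ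
  have hdiff : Differentiable ℂ Φ := by
    refine differentiable_integral_of_dominated (fun z => ?_) (fun ξ => ?_) fun R => ?_
    · exact (hg.continuous.comp (continuous_toC_smul η z)).aestronglyMeasurable
    · refine hg.comp ?_
      fun_prop
    · obtain ⟨C, hC⟩ := hb (R * ‖η‖)
      refine ⟨fun ξ => C * (1 + R * ‖η‖) ^ (d + 1) * ((1 + ‖ξ‖) ^ (d + 1))⁻¹,
        (integrable_one_add_norm_inv_pow d).const_mul _, fun z hz ξ => ?_⟩
      beta_reduce
      rw [toC_add_smul, ← div_eq_mul_inv, le_div_iff₀ (by positivity)]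
      have hR : 0 ≤ R := (norm_nonneg z).trans hz
      have h1 : ‖z.im • η‖ ≤ R * ‖η‖ := by
        rw [norm_smul]
        gcongr
        exact (Complex.abs_im_le_norm z).trans hz
      have h2 : ‖z.re • η‖ ≤ R * ‖η‖ := by
        rw [norm_smul]
        gcongr
        exact (Complex.abs_re_le_norm z).trans hz
      have h3 : 1 + ‖ξ‖ ≤ (1 + ‖ξ + z.re • η‖) * (1 + R * ‖η‖) := by
        have h4 : ‖ξ‖ ≤ ‖ξ + z.re • η‖ + ‖z.re • η‖ := by
          simpa using norm_sub_le (ξ + z.re • η) (z.re • η)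
        have : 0 ≤ ‖ξ + z.re • η‖ * (R * ‖η‖) := by positivity
        linarith
      calc ‖g (toC (ξ + z.re • η) (z.im • η))‖ * (1 + ‖ξ‖) ^ (d + 1)
          ≤ ‖g (toC (ξ + z.re • η) (z.im • η))‖ *
            ((1 + ‖ξ + z.re • η‖) * (1 + R * ‖η‖)) ^ (d + 1) := by gcongr
        _ = (‖g (toC (ξ + z.re • η) (z.im • η))‖ * (1 + ‖ξ + z.re • η‖) ^ (d + 1)) *
            (1 + R * ‖η‖) ^ (d + 1) := by rw [mul_pow]; ring
        _ ≤ _ := by gcongr; exact hC _ _ h1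
  have htrans : ∀ (z : ℂ) (t : ℝ), Φ (z + t) = Φ z := by
    intro z t
    simp only [hΦ]
    rw [← integral_add_right_eq_self (fun ξ : Rd d => g fun k => (ξ k : ℂ) + z * (η k : ℂ)) (t • η)]
    refine integral_congr_ae (Eventually.of_forall fun ξ => ?_)
    simp only [PiLp.add_apply, PiLp.smul_apply, smul_eq_mul]
    congr 1
    funext k
    push_cast
    ring
  have hderiv : ∀ z, deriv Φ z = 0 := by
    intro z
    have h1 : HasDerivAt (fun w => Φ (z + w)) (deriv Φ z) ((0 : ℝ) : ℂ) := by
      refine HasDerivAt.comp_const_add z _ ?_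
      simpa using (hdiff z).hasDerivAt
    have h2 := h1.comp_ofReal
    simp only [htrans] at h2
    exact h2.unique (hasDerivAt_const _ _)
  have := is_const_of_deriv_eq_zero hdiff hderiv Complex.I 0
  simp only [hΦ, toC_add_smul] at this
  simpa using this

/-- The exponential `exp (2πi x·ζ)` for `x ∈ ℝ^d`, `ζ ∈ ℂ^d`. -/
def expKer {d : ℕ} (x : Rd d) (ζ : Fin d → ℂ) : ℂ :=
  Complex.exp (2 * Real.pi * Complex.I * ∑ k, (x k : ℂ) * ζ k)

/-- The inverse Fourier transform of the restriction of `g` to `ℝ^d`. -/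
def invLap {d : ℕ} (g : (Fin d → ℂ) → ℂ) (x : Rd d) : ℂ := ∫ ξ : Rd d, g (toC ξ 0) * expKer x (toC ξ 0)

/-- `g` is continuous on `ℝ^d` and decreases faster than any power. -/
def RapidDecay {d : ℕ} (g : (Fin d → ℂ) → ℂ) : Prop :=
  (Continuous fun ξ : Rd d => g (toC ξ 0)) ∧
    ∀ n : ℕ, ∃ C, ∀ ξ : Rd d, ‖g (toC ξ 0)‖ * (1 + ‖ξ‖) ^ n ≤ C

lemma toC_zero_apply {d : ℕ} (ξ : Rd d) (k : Fin d) : toC ξ 0 k = (ξ k : ℂ) := by simp [toC]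

lemma norm_expKer_toC {d : ℕ} (x ξ η : Rd d) :
    ‖expKer x (toC ξ η)‖ = Real.exp (-(2 * Real.pi * ∑ k, x k * η k)) := by
  rw [expKer, Complex.norm_exp]
  congr 1
  have : 2 * Real.pi * Complex.I * ∑ k, (x k : ℂ) * toC ξ η k =
      ((-(2 * Real.pi * ∑ k, x k * η k) : ℝ) : ℂ) +
      ((2 * Real.pi * ∑ k, x k * ξ k : ℝ) : ℂ) * Complex.I := by
    simp only [toC, mul_add, Finset.sum_add_distrib]
    push_cast
    simp only [← mul_assoc, ← Finset.sum_mul]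
    linear_combination (2 * Real.pi * ∑ k, (x k : ℂ) * η k) * Complex.I_mul_I
  rw [this]
  simp

lemma norm_expKer_toC_zero {d : ℕ} (x ξ : Rd d) : ‖expKer x (toC ξ 0)‖ = 1 := by
  rw [norm_expKer_toC]; simp

lemma differentiable_expKer {d : ℕ} (x : Rd d) : Differentiable ℂ (expKer x) := by
  unfold expKer
  fun_prop

lemma norm_toC_apply_le {d : ℕ} (ξ η : Rd d) (k : Fin d) : ‖toC ξ η k‖ ≤ ‖ξ‖ + ‖η‖ := by
  refine (norm_add_le _ _).trans ?_
  simpa using add_le_add (abs_coord_le ξ k) (abs_coord_le η k)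

lemma norm_two_pi_I : ‖(2 * Real.pi * Complex.I : ℂ)‖ = 2 * Real.pi := by
  simp [abs_of_pos Real.pi_pos]

lemma integrable_of_decay {d : ℕ} {f : Rd d → ℂ} (hf : Continuous f) {C : ℝ}
    (hC : ∀ ξ, ‖f ξ‖ * (1 + ‖ξ‖) ^ (d + 1) ≤ C) : Integrable f := by
  refine ((integrable_one_add_norm_inv_pow d).const_mul C).mono' hf.aestronglyMeasurable
    (Eventually.of_forall fun ξ => ?_)
  rw [← div_eq_mul_inv, le_div_iff₀ (by positivity)]
  exact hC ξ

namespace RapidDecay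

variable {d : ℕ} {g : (Fin d → ℂ) → ℂ}

lemma mul_coord (hg : RapidDecay g) (j : Fin d) :
    RapidDecay fun ζ => 2 * Real.pi * Complex.I * ζ j * g ζ := by
  refine ⟨?_, fun n => ?_⟩
  · simp only [toC_zero_apply]
    exact Continuous.mul (by fun_prop) hg.1
  · obtain ⟨C, hC⟩ := hg.2 (n + 1)
    refine ⟨2 * Real.pi * C, fun ξ => ?_⟩
    rw [norm_mul, norm_mul, norm_two_pi_I, toC_zero_apply, Complex.norm_real, Real.norm_eq_abs]
    have h1 := abs_coord_le ξ j
    have hpi := Real.pi_pos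
    calc 2 * Real.pi * |ξ j| * ‖g (toC ξ 0)‖ * (1 + ‖ξ‖) ^ n
        ≤ 2 * Real.pi * (1 + ‖ξ‖) * ‖g (toC ξ 0)‖ * (1 + ‖ξ‖) ^ n := by gcongr; linarith
      _ = 2 * Real.pi * (‖g (toC ξ 0)‖ * (1 + ‖ξ‖) ^ (n + 1)) := by ring
      _ ≤ _ := by gcongr; exact hC ξ

lemma integrable_norm_pow (hg : RapidDecay g) (n : ℕ) :
    Integrable fun ξ : Rd d => ‖ξ‖ ^ n * ‖g (toC ξ 0)‖ := by
  obtain ⟨C, hC⟩ := hg.2 (n + (d + 1))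
  refine ((integrable_one_add_norm_inv_pow d).const_mul C).mono'
    ((continuous_norm.pow n).mul hg.1.norm).aestronglyMeasurable (Eventually.of_forall fun ξ => ?_)
  rw [← div_eq_mul_inv, le_div_iff₀ (by positivity), Real.norm_of_nonneg (by positivity)]
  refine le_trans ?_ (hC ξ)
  rw [pow_add _ n (d + 1), mul_comm (‖ξ‖ ^ n), mul_assoc]
  have h1 : ‖ξ‖ ^ n ≤ (1 + ‖ξ‖) ^ n := by gcongr; linarith
  gcongr

lemma integrable (hg : RapidDecay g) : Integrable fun ξ : Rd d => g (toC ξ 0) := by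
  obtain ⟨C, hC⟩ := hg.2 (d + 1)
  exact integrable_of_decay hg.1 hC

end RapidDecay

lemma expKer_eq_fourierChar {d : ℕ} (x ξ : Rd d) :
    expKer x (toC ξ 0) = (Real.fourierChar (inner ℝ ξ x) : ℂ) := by
  rw [expKer, Real.fourierChar_apply]
  congr 1
  simp only [toC_zero_apply, PiLp.inner_apply]
  push_cast
  simp only [RCLike.inner_apply, conj_trivial]
  push_cast
  ring

lemma invLap_eq_fourierInv {d : ℕ} (g : (Fin d → ℂ) → ℂ) :
    invLap g = FourierTransformInv.fourierInv (fun ξ : Rd d => g (toC ξ 0)) := by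
  funext x
  rw [Real.fourierInv_eq, invLap]
  refine integral_congr_ae (Eventually.of_forall fun ξ => ?_)
  simp only [expKer_eq_fourierChar, Circle.smul_def, smul_eq_mul, mul_comm]

lemma RapidDecay.contDiff_invLap {d : ℕ} {g : (Fin d → ℂ) → ℂ} (hg : RapidDecay g) :
    ContDiff ℝ (⊤ : ℕ∞) (invLap g) := by
  have h : invLap g = fun x => FourierTransform.fourier (fun ξ : Rd d => g (toC ξ 0)) (-x) := by
    rw [invLap_eq_fourierInv]
    funext x
    exact Real.fourierInv_eq_fourier_neg _ _
  rw [h]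
  exact (Real.contDiff_fourier fun n _ => hg.integrable_norm_pow n).comp contDiff_neg

lemma RapidDecay.dop_invLap {d : ℕ} {g : (Fin d → ℂ) → ℂ} (hg : RapidDecay g) (j : Fin d) :
    dop j (invLap g) = invLap fun ζ => 2 * Real.pi * Complex.I * ζ j * g ζ := by
  funext x
  set e : Rd d := EuclideanSpace.single j (1 : ℝ) with he
  have h1 : HasDerivAt (fun t : ℝ => invLap g (x + t • e)) (dop j (invLap g) x) 0 := by
    have hd : DifferentiableAt ℝ (invLap g) x :=
      (hg.contDiff_invLap.differentiable (by simp)).differentiableAt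
    have h2 : HasFDerivAt (invLap g) (fderiv ℝ (invLap g) x) (x + (0 : ℝ) • e) := by
      simpa using hd.hasFDerivAt
    have h3 : HasDerivAt (fun t : ℝ => x + t • e) e 0 := by
      simpa using ((hasDerivAt_id (0 : ℝ)).smul_const e).const_add x
    exact h2.comp_hasDerivAt 0 h3
  have hker : ∀ (t : ℝ) (ξ : Rd d), HasDerivAt (fun t : ℝ => g (toC ξ 0) * expKer (x + t • e) (toC ξ 0))
      (2 * Real.pi * Complex.I * toC ξ 0 j * g (toC ξ 0) * expKer (x + t • e) (toC ξ 0)) t := by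
    intro t ξ
    have h4 : ∀ t : ℝ, expKer (x + t • e) (toC ξ 0) = Complex.exp (2 * Real.pi * Complex.I *
        (∑ k, (x k : ℂ) * toC ξ 0 k + t * toC ξ 0 j)) := by
      intro t
      rw [expKer]
      congr 2
      simp only [PiLp.add_apply, PiLp.smul_apply, smul_eq_mul, he, PiLp.single_apply]
      push_cast
      simp [add_mul, Finset.sum_add_distrib, apply_ite Complex.ofReal]
    simp only [h4]
    have h5 : HasDerivAt (fun t : ℝ => (t : ℂ) * toC ξ 0 j) (toC ξ 0 j) t := by
      simpa using (HasDerivAt.ofReal_comp (hasDerivAt_id t)).mul_const (toC ξ 0 j)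
    have h6 := (((h5.const_add (∑ k, (x k : ℂ) * toC ξ 0 k)).const_mul
      (2 * Real.pi * Complex.I)).cexp).const_mul (g (toC ξ 0))
    refine h6.congr_deriv ?_
    ring
  have hcont : ∀ y : Rd d, Continuous fun ξ : Rd d => expKer y (toC ξ 0) := fun y =>
    (differentiable_expKer y).continuous.comp (continuous_toC_left 0)
  have h7 : HasDerivAt (fun t : ℝ => invLap g (x + t • e))
      (∫ ξ : Rd d, 2 * Real.pi * Complex.I * toC ξ 0 j * g (toC ξ 0) *
        expKer (x + (0 : ℝ) • e) (toC ξ 0)) 0 := by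
    have hg1 := hg.1
    have hg2 := (hg.mul_coord j).1
    have hk := hcont (x + (0 : ℝ) • e)
    refine (hasDerivAt_integral_of_dominated_loc_of_deriv_le (univ_mem)
      (bound := fun ξ => ‖2 * Real.pi * Complex.I * toC ξ 0 j * g (toC ξ 0)‖)
      (F := fun (t : ℝ) (ξ : Rd d) => g (toC ξ 0) * expKer (x + t • e) (toC ξ 0))
      (F' := fun (t : ℝ) (ξ : Rd d) => 2 * Real.pi * Complex.I * toC ξ 0 j * g (toC ξ 0) *
        expKer (x + t • e) (toC ξ 0))
      (Eventually.of_forall fun t => ?_) ?_ ?_ ?_ ?_ ?_).2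
    · exact (hg1.mul (hcont _)).aestronglyMeasurable
    · refine hg.integrable.norm.mono' (hg1.mul hk).aestronglyMeasurable
        (Eventually.of_forall fun ξ => ?_)
      rw [norm_mul, norm_expKer_toC_zero, mul_one]
    · exact (hg2.mul hk).aestronglyMeasurable
    · refine Eventually.of_forall fun ξ t _ => ?_
      rw [norm_mul _ (expKer _ _), norm_expKer_toC_zero, mul_one]
    · exact (hg.mul_coord j).integrable.norm
    · exact Eventually.of_forall fun ξ t _ => hker t ξ
  rw [h1.unique h7, invLap, zero_smul, add_zero]

lemma RapidDecay.pD_invLap {d : ℕ} {g : (Fin d → ℂ) → ℂ} (hg : RapidDecay g) (α : Fin d → ℕ) :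
    pD α (invLap g) = invLap fun ζ => (∏ j, (2 * Real.pi * Complex.I * ζ j) ^ α j) * g ζ := by
  have hiter : ∀ (j : Fin d) (n : ℕ) {g : (Fin d → ℂ) → ℂ}, RapidDecay g →
      (dop j)^[n] (invLap g) = invLap (fun ζ => (2 * Real.pi * Complex.I * ζ j) ^ n * g ζ) ∧
      RapidDecay fun ζ => (2 * Real.pi * Complex.I * ζ j) ^ n * g ζ := by
    intro j n
    induction n with
    | zero => intro g hg; simpa using hg
    | succ n ih =>
      intro g hg
      have h1 := ih (hg.mul_coord j)
      rw [Function.iterate_succ_apply, hg.dop_invLap j]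
      simpa only [pow_succ, mul_assoc] using h1
  have hlist : ∀ l : List (Fin d),
      l.foldr (fun j f => (dop j)^[α j] f) (invLap g) =
        invLap (fun ζ => (l.map fun j => (2 * Real.pi * Complex.I * ζ j) ^ α j).prod * g ζ) ∧
      RapidDecay fun ζ => (l.map fun j => (2 * Real.pi * Complex.I * ζ j) ^ α j).prod * g ζ := by
    intro l
    induction l with
    | nil => simpa using hg
    | cons j l ih =>
      have h1 := hiter j (α j) ih.2
      simp only [List.foldr_cons, List.map_cons, List.prod_cons, ih.1]
      simpa only [mul_assoc] using h1
  rw [pD, (hlist _).1]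
  simp only [Fin.prod_univ_def]

namespace IsWeightSeq

variable {M : ℕ → ℝ} {C₀ H h : ℝ} {d : ℕ}

lemma exists_one_add_pow_le_assocW (hM : IsWeightSeq M) (hh : 0 < h) (n : ℕ) :
    ∃ C, 0 < C ∧ ∀ t, 0 ≤ t → (1 + t) ^ n ≤ C * assocW M (h * t) := by
  have hMn := hM.pos n
  refine ⟨2 ^ n * (1 + M n / h ^ n), by positivity, fun t ht => ?_⟩
  have h1 := hM.pow_le (t := h * t) (by positivity) n
  have h2 := hM.one_le_assocW (h * t)
  have h3 : (1 + t) ^ n ≤ 2 ^ n * (1 + t ^ n) := by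
    rcases le_total t 1 with h4 | h4
    · calc (1 + t) ^ n ≤ 2 ^ n := by gcongr; linarith
        _ ≤ _ := by
          have : 0 ≤ (2 : ℝ) ^ n * t ^ n := by positivity
          linarith
    · calc (1 + t) ^ n ≤ (2 * t) ^ n := by gcongr; linarith
        _ ≤ _ := by
          rw [mul_pow]
          have : 0 ≤ (2 : ℝ) ^ n := by positivity
          linarith
  rw [mul_pow, ← le_div_iff₀' (by positivity)] at h1
  refine h3.trans ?_
  rw [mul_assoc, add_mul, one_mul]
  gcongr
  rwa [div_mul_eq_mul_div]

lemma exists_decay_of_stripBd (hM : IsWeightSeq M) (hh : 0 < h) {g : (Fin d → ℂ) → ℂ} {R C : ℝ}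
    (hg : StripBd M h R C g) (n : ℕ) :
    ∃ C', ∀ ξ η : Rd d, ‖η‖ ≤ R → ‖g (toC ξ η)‖ * (1 + ‖ξ‖) ^ n ≤ C' := by
  obtain ⟨A, hA, h1⟩ := hM.exists_one_add_pow_le_assocW hh n
  refine ⟨A * C, fun ξ η hη => ?_⟩
  calc ‖g (toC ξ η)‖ * (1 + ‖ξ‖) ^ n ≤ ‖g (toC ξ η)‖ * (A * assocW M (h * ‖ξ‖)) := by
        gcongr; exact h1 _ (norm_nonneg _)
    _ = A * (‖g (toC ξ η)‖ * assocW M (h * ‖ξ‖)) := by ring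
    _ ≤ _ := by gcongr; exact hg ξ η hη

lemma rapidDecay_of_stripBd (hM : IsWeightSeq M) (hh : 0 < h) {g : (Fin d → ℂ) → ℂ}
    (hc : Continuous g) {C : ℝ} (hg : StripBd M h 0 C g) : RapidDecay g := by
  refine ⟨hc.comp (continuous_toC_left 0), fun n => ?_⟩
  obtain ⟨C', hC'⟩ := hM.exists_decay_of_stripBd hh hg n
  exact ⟨C', fun ξ => hC' ξ 0 (by simp)⟩

lemma exists_seminorm_bound (hM : IsWeightSeq M) (h2 : HasM2 M C₀ H) (hh : 0 < h) (d n : ℕ) :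
    ∃ J R : ℝ, 0 ≤ J ∧ ∀ g : (Fin d → ℂ) → ℂ, Differentiable ℂ g → (∀ R, ∃ C, StripBd M h R C g) →
      ∀ C, StripBd M h R C g → ∀ (α : Fin d → ℕ) (x : Rd d),
        (h / (4 * Real.pi * H)) ^ msize α * ‖pD α (invLap g) x‖ * Real.exp (n * ‖x‖) ≤
          J * C * M (msize α) := by
  have hpi := Real.pi_pos
  obtain ⟨hC₀, hH, -⟩ := id h2
  set a := h / H with ha
  have ha0 : 0 < a := by positivity
  obtain ⟨A, hA, hAle⟩ := hM.exists_one_add_pow_le_assocW ha0 (d + 1)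
  set s : ℝ := n / (2 * Real.pi) with hs
  have hs0 : 0 ≤ s := by positivity
  have hWs := hM.assocW_pos (a * s)
  set I := ∫ ξ : Rd d, ((1 + ‖ξ‖) ^ (d + 1))⁻¹ with hI
  have hI0 : 0 ≤ I := integral_nonneg fun ξ => by positivity
  refine ⟨assocW M (a * s) * C₀ * A * I, s, by positivity, fun g hg hgb C hgC α x => ?_⟩
  set p := msize α with hp
  have hMp := hM.pos p
  have hrapid : RapidDecay g := by
    obtain ⟨C, hC⟩ := hgb 0
    exact hM.rapidDecay_of_stripBd hh hg.continuous hC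
  set G : (Fin d → ℂ) → ℂ := fun ζ => (∏ j, (2 * Real.pi * Complex.I * ζ j) ^ α j) * g ζ * expKer x ζ
    with hG
  have hprod : ∀ ξ η : Rd d, ‖∏ j, (2 * Real.pi * Complex.I * toC ξ η j) ^ α j‖ ≤
      (2 * Real.pi * (‖ξ‖ + ‖η‖)) ^ p := by
    intro ξ η
    rw [norm_prod, hp, msize, ← Finset.prod_pow_eq_pow_sum]
    refine Finset.prod_le_prod (fun _ _ => norm_nonneg _) fun j _ => ?_
    rw [norm_pow, norm_mul, norm_two_pi_I]
    gcongr
    exact norm_toC_apply_le ξ η j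
  have hGd : Differentiable ℂ G := by
    have := differentiable_expKer x
    fun_prop
  have hGb : ∀ R : ℝ, ∃ C, ∀ ξ η : Rd d, ‖η‖ ≤ R → ‖G (toC ξ η)‖ * (1 + ‖ξ‖) ^ (d + 1) ≤ C := by
    intro R
    obtain ⟨D, hD⟩ := hgb R
    obtain ⟨D', hD'⟩ := hM.exists_decay_of_stripBd hh hD (p + (d + 1))
    refine ⟨(2 * Real.pi * (1 + R)) ^ p * Real.exp (2 * Real.pi * (‖x‖ * R)) * D',
      fun ξ η hη => ?_⟩
    have hR : 0 ≤ R := (norm_nonneg _).trans hη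
    have h3 : ‖∏ j, (2 * Real.pi * Complex.I * toC ξ η j) ^ α j‖ ≤
        (2 * Real.pi * (1 + R)) ^ p * (1 + ‖ξ‖) ^ p := by
      refine (hprod ξ η).trans ?_
      have h5 : ‖ξ‖ + ‖η‖ ≤ (1 + R) * (1 + ‖ξ‖) := by nlinarith [norm_nonneg ξ]
      rw [← mul_pow, mul_assoc _ (1 + R)]
      exact pow_le_pow_left₀ (by positivity) (mul_le_mul_of_nonneg_left h5 (by positivity)) p
    have h4 : ‖expKer x (toC ξ η)‖ ≤ Real.exp (2 * Real.pi * (‖x‖ * R)) := by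
      rw [norm_expKer_toC]
      refine Real.exp_le_exp.2 ?_
      have h5 : |∑ k, x k * η k| ≤ ‖x‖ * ‖η‖ := by
        have := abs_real_inner_le_norm η x
        rw [mul_comm ‖η‖] at this
        simpa [PiLp.inner_apply] using this
      have h6 : ‖x‖ * ‖η‖ ≤ ‖x‖ * R := by gcongr
      have h7 := neg_abs_le (∑ k, x k * η k)
      have h8 : 0 ≤ 2 * Real.pi * (‖x‖ * R + ∑ k, x k * η k) :=
        mul_nonneg (by positivity) (by linarith)
      linarith
    calc ‖G (toC ξ η)‖ * (1 + ‖ξ‖) ^ (d + 1)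
        ≤ ((2 * Real.pi * (1 + R)) ^ p * (1 + ‖ξ‖) ^ p) * ‖g (toC ξ η)‖ *
          Real.exp (2 * Real.pi * (‖x‖ * R)) * (1 + ‖ξ‖) ^ (d + 1) := by
          rw [hG, norm_mul, norm_mul]; gcongr
      _ = (2 * Real.pi * (1 + R)) ^ p * Real.exp (2 * Real.pi * (‖x‖ * R)) *
          (‖g (toC ξ η)‖ * (1 + ‖ξ‖) ^ (p + (d + 1))) := by ring
      _ ≤ _ := by gcongr; exact hD' ξ η hη
  set η : Rd d := s • (‖x‖⁻¹ • x) with hη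
  have hηs : ‖η‖ ≤ s := by
    rw [hη, norm_smul, norm_smul, norm_inv, norm_norm, Real.norm_of_nonneg hs0]
    exact mul_le_of_le_one_right hs0 (inv_mul_le_one)
  have hker : ∀ ξ, ‖expKer x (toC ξ η)‖ = Real.exp (-(n * ‖x‖)) := by
    intro ξ
    rw [norm_expKer_toC]
    congr 2
    have h5 : ∑ k, x k * η k = s * ‖x‖ := by
      have h6 : ∑ k, x k * η k = inner ℝ η x := by simp [PiLp.inner_apply]
      rw [h6, hη, inner_smul_left, inner_smul_left, real_inner_self_eq_norm_sq]
      rcases eq_or_ne ‖x‖ 0 with h0 | h0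
      · simp [h0]
      · simp only [conj_trivial]; field_simp
    rw [h5, hs]
    field_simp
  have hval : pD α (invLap g) x = ∫ ξ : Rd d, G (toC ξ η) := by
    rw [hrapid.pD_invLap, integral_toC_eq hGd hGb, invLap]
  have hWsq : ∀ ξ : Rd d, assocW M (a * ‖ξ‖) ^ 2 ≤ C₀ * assocW M (h * ‖ξ‖) := by
    intro ξ
    have := hM.assocW_sq_le h2 (t := a * ‖ξ‖) (by positivity)
    rwa [← mul_assoc, ha, mul_div_cancel₀ _ (by positivity)] at this
  have hkey : ∀ ξ : Rd d, ‖G (toC ξ η)‖ ≤ (h / (4 * Real.pi * H))⁻¹ ^ p * Real.exp (-(n * ‖x‖)) *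
      (M p * assocW M (a * s) * C₀ * A * C) * ((1 + ‖ξ‖) ^ (d + 1))⁻¹ := by
    intro ξ
    have hW := hM.assocW_pos (a * ‖ξ‖)
    have hWh := hM.assocW_pos (h * ‖ξ‖)
    have h6 : (a * max ‖ξ‖ s) ^ p ≤ M p * (assocW M (a * ‖ξ‖) * assocW M (a * s)) := by
      refine (hM.pow_le (by positivity) p).trans ?_
      gcongr
      have h7 := hM.one_le_assocW (a * ‖ξ‖)
      have h8 := hM.one_le_assocW (a * s)
      rcases max_choice ‖ξ‖ s with h9 | h9 <;> rw [h9] <;> nlinarith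
    have h7 : (2 * Real.pi * (‖ξ‖ + ‖η‖)) ^ p ≤
        (h / (4 * Real.pi * H))⁻¹ ^ p * (a * max ‖ξ‖ s) ^ p := by
      rw [← mul_pow]
      refine pow_le_pow_left₀ (by positivity) ?_ p
      have h8 : (h / (4 * Real.pi * H))⁻¹ * (a * max ‖ξ‖ s) = 2 * Real.pi * (2 * max ‖ξ‖ s) := by
        rw [ha]; field_simp; ring
      rw [h8]
      gcongr
      linarith [le_max_left ‖ξ‖ s, le_max_right ‖ξ‖ s]
    have h8 : assocW M (a * ‖ξ‖) * ‖g (toC ξ η)‖ ≤ C₀ * A * C * ((1 + ‖ξ‖) ^ (d + 1))⁻¹ := by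
      rw [← div_eq_mul_inv, le_div_iff₀ (by positivity)]
      calc assocW M (a * ‖ξ‖) * ‖g (toC ξ η)‖ * (1 + ‖ξ‖) ^ (d + 1)
          ≤ assocW M (a * ‖ξ‖) * ‖g (toC ξ η)‖ * (A * assocW M (a * ‖ξ‖)) := by
            gcongr; exact hAle _ (norm_nonneg _)
        _ = ‖g (toC ξ η)‖ * A * assocW M (a * ‖ξ‖) ^ 2 := by ring
        _ ≤ ‖g (toC ξ η)‖ * A * (C₀ * assocW M (h * ‖ξ‖)) := by gcongr; exact hWsq ξ
        _ = C₀ * A * (‖g (toC ξ η)‖ * assocW M (h * ‖ξ‖)) := by ring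
        _ ≤ _ := by gcongr; exact hgC ξ η hηs
    rw [hG]
    simp only
    rw [norm_mul, norm_mul, hker]
    calc _ ≤ (h / (4 * Real.pi * H))⁻¹ ^ p * (M p * (assocW M (a * ‖ξ‖) * assocW M (a * s))) *
          ‖g (toC ξ η)‖ * Real.exp (-(n * ‖x‖)) := by
          gcongr
          exact (hprod ξ η).trans (h7.trans (by gcongr))
      _ = (h / (4 * Real.pi * H))⁻¹ ^ p * Real.exp (-(n * ‖x‖)) * (M p * assocW M (a * s)) *
          (assocW M (a * ‖ξ‖) * ‖g (toC ξ η)‖) := by ring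
      _ ≤ (h / (4 * Real.pi * H))⁻¹ ^ p * Real.exp (-(n * ‖x‖)) * (M p * assocW M (a * s)) *
          (C₀ * A * C * ((1 + ‖ξ‖) ^ (d + 1))⁻¹) := by gcongr
      _ = _ := by ring
  have hnorm := norm_integral_le_of_norm_le ((integrable_one_add_norm_inv_pow d).const_mul _)
    (Eventually.of_forall hkey)
  rw [integral_const_mul, ← hval] at hnorm
  calc (h / (4 * Real.pi * H)) ^ p * ‖pD α (invLap g) x‖ * Real.exp (n * ‖x‖)
      ≤ (h / (4 * Real.pi * H)) ^ p * ((h / (4 * Real.pi * H))⁻¹ ^ p * Real.exp (-(n * ‖x‖)) *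
        (M p * assocW M (a * s) * C₀ * A * C) * I) * Real.exp (n * ‖x‖) := by gcongr
    _ = ((h / (4 * Real.pi * H)) * (h / (4 * Real.pi * H))⁻¹) ^ p *
        (Real.exp (-(n * ‖x‖)) * Real.exp (n * ‖x‖)) *
        (M p * assocW M (a * s) * C₀ * A * C) * I := by rw [mul_pow]; ring
    _ = _ := by
        rw [mul_inv_cancel₀ (by positivity), ← Real.exp_add, neg_add_cancel, Real.exp_zero]
        ring

end IsWeightSeq

/-- The Fourier–Laplace transform of `φ`. -/
def lapl {d : ℕ} (φ : Rd d → ℂ) (ζ : Fin d → ℂ) : ℂ := ∫ x : Rd d, φ x * expKer (-x) ζ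

/-- Smooth functions all of whose derivatives decrease faster than any exponential. -/
def ExpDecay {d : ℕ} (φ : Rd d → ℂ) : Prop :=
  ContDiff ℝ (⊤ : ℕ∞) φ ∧ ∀ (n : ℕ) (α : Fin d → ℕ), ∃ C, ∀ x : Rd d,
    ‖pD α φ x‖ * Real.exp (n * ‖x‖) ≤ C

lemma continuous_expKer_left {d : ℕ} (ζ : Fin d → ℂ) : Continuous fun x : Rd d => expKer (-x) ζ := by
  unfold expKer
  fun_prop

lemma norm_expKer_neg_toC_le {d : ℕ} (x ξ η : Rd d) :
    ‖expKer (-x) (toC ξ η)‖ ≤ Real.exp (2 * Real.pi * (‖x‖ * ‖η‖)) := by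
  rw [norm_expKer_toC]
  refine Real.exp_le_exp.2 ?_
  have h5 : |∑ k, x k * η k| ≤ ‖x‖ * ‖η‖ := by
    have := abs_real_inner_le_norm η x
    rw [mul_comm ‖η‖] at this
    simpa [PiLp.inner_apply] using this
  have h6 : ∑ k, (-x) k * η k = -∑ k, x k * η k := by simp
  rw [h6, mul_neg, neg_neg]
  have := le_abs_self (∑ k, x k * η k)
  have hpi := Real.pi_pos
  gcongr
  linarith

lemma norm_expKer_le {d : ℕ} (x : Rd d) (ζ : Fin d → ℂ) :
    ‖expKer x ζ‖ ≤ Real.exp (2 * Real.pi * d * ‖ζ‖ * ‖x‖) := by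
  refine (Complex.norm_exp_le_exp_norm _).trans (Real.exp_le_exp.2 ?_)
  rw [norm_mul, norm_two_pi_I, mul_assoc (2 * Real.pi), mul_assoc (2 * Real.pi)]
  have hpi := Real.pi_pos
  gcongr
  refine (norm_sum_le_of_le (f := fun k => (x k : ℂ) * ζ k) Finset.univ
    (n := fun _ => ‖ζ‖ * ‖x‖) fun k _ => ?_).trans (by simp [mul_assoc])
  rw [norm_mul, mul_comm, Complex.norm_real]
  gcongr
  · exact norm_le_pi_norm ζ k
  · exact abs_coord_le x k

lemma one_add_pow_le_exp (n : ℕ) {t : ℝ} (ht : 0 ≤ t) :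
    (1 + t) ^ n ≤ n.factorial * Real.exp 1 * Real.exp t := by
  have h1 := Real.pow_div_factorial_le_exp (1 + t) (by positivity) n
  rw [div_le_iff₀ (by positivity), Real.exp_add] at h1
  linarith

lemma integrable_exp_neg_norm (d : ℕ) : Integrable fun x : Rd d => Real.exp (-‖x‖) := by
  refine ((integrable_one_add_norm_inv_pow d).const_mul
    ((d + 1).factorial * Real.exp 1)).mono' (by fun_prop) (Eventually.of_forall fun x => ?_)
  rw [← div_eq_mul_inv, le_div_iff₀ (by positivity), Real.norm_of_nonneg (Real.exp_pos _).le]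
  calc Real.exp (-‖x‖) * (1 + ‖x‖) ^ (d + 1)
      ≤ Real.exp (-‖x‖) * ((d + 1).factorial * Real.exp 1 * Real.exp ‖x‖) := by
        gcongr; exact one_add_pow_le_exp _ (norm_nonneg _)
    _ = (d + 1).factorial * Real.exp 1 * (Real.exp (-‖x‖) * Real.exp ‖x‖) := by ring
    _ = _ := by rw [← Real.exp_add, neg_add_cancel, Real.exp_zero, mul_one]

/-- The differential of `ζ ↦ 2πi x·ζ`. -/
def phaseCLM {d : ℕ} (x : Rd d) : (Fin d → ℂ) →L[ℂ] ℂ :=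
  (2 * Real.pi * Complex.I : ℂ) • ∑ k, (x k : ℂ) • ContinuousLinearMap.proj (R := ℂ) k

lemma phaseCLM_apply {d : ℕ} (x : Rd d) (ζ : Fin d → ℂ) :
    phaseCLM x ζ = 2 * Real.pi * Complex.I * ∑ k, (x k : ℂ) * ζ k := by
  simp [phaseCLM]

lemma hasFDerivAt_expKer {d : ℕ} (x : Rd d) (ζ : Fin d → ℂ) :
    HasFDerivAt (expKer x) (expKer x ζ • phaseCLM x) ζ := by
  have h : expKer x = fun ζ => Complex.exp (phaseCLM x ζ) := by
    funext ζ
    simp [expKer, phaseCLM_apply]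
  rw [h]
  exact (phaseCLM x).hasFDerivAt.cexp

lemma norm_phaseCLM_le {d : ℕ} (x : Rd d) : ‖phaseCLM x‖ ≤ 2 * Real.pi * d * ‖x‖ := by
  have hpi := Real.pi_pos
  refine ContinuousLinearMap.opNorm_le_bound _ (by positivity) fun ζ => ?_
  rw [phaseCLM_apply, norm_mul, norm_two_pi_I, mul_assoc (2 * Real.pi), mul_assoc (2 * Real.pi)]
  gcongr
  refine (norm_sum_le_of_le (f := fun k => (x k : ℂ) * ζ k) Finset.univ
    (n := fun _ => ‖x‖ * ‖ζ‖) fun k _ => ?_).trans (by simp [mul_assoc])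
  rw [norm_mul, Complex.norm_real]
  gcongr
  · exact abs_coord_le x k
  · exact norm_le_pi_norm ζ k

lemma pD_zero {d : ℕ} (φ : Rd d → ℂ) : pD 0 φ = φ := by
  have : ∀ l : List (Fin d), l.foldr (fun j f => (dop j)^[(0 : Fin d → ℕ) j] f) φ = φ := by
    intro l
    induction l with
    | nil => rfl
    | cons j l ih => rw [List.foldr_cons, ih]; rfl
  exact this _

lemma pD_single {d : ℕ} (φ : Rd d → ℂ) (k : Fin d) (p : ℕ) :
    pD (Pi.single k p) φ = (dop k)^[p] φ := by
  have h : ∀ l : List (Fin d), l.Nodup →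
      l.foldr (fun j f => (dop j)^[(Pi.single k p : Fin d → ℕ) j] f) φ =
        if k ∈ l then (dop k)^[p] φ else φ := by
    intro l
    induction l with
    | nil => simp
    | cons j l ih =>
      intro hl
      rw [List.nodup_cons] at hl
      rw [List.foldr_cons, ih hl.2]
      rcases eq_or_ne j k with rfl | hjk
      · simp [hl.1]
      · simp [hjk.symm]
  rw [pD, h _ (List.nodup_finRange d), if_pos (List.mem_finRange k)]

lemma msize_single {d : ℕ} (k : Fin d) (p : ℕ) : msize (Pi.single k p : Fin d → ℕ) = p := by
  simp [msize]

lemma contDiff_dop_iterate {d : ℕ} {φ : Rd d → ℂ} (hφ : ContDiff ℝ (⊤ : ℕ∞) φ) (k : Fin d) (p : ℕ) :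
    ContDiff ℝ (⊤ : ℕ∞) ((dop k)^[p] φ) := by
  induction p with
  | zero => exact hφ
  | succ p ih =>
    rw [Function.iterate_succ_apply']
    exact (ih.fderiv_right (m := ((⊤ : ℕ∞) : WithTop ℕ∞)) (by simp)).clm_apply contDiff_const

/-- Continuous functions that decrease faster than any exponential. -/
def SuperExp {d : ℕ} (f : Rd d → ℂ) : Prop :=
  Continuous f ∧ ∀ n : ℕ, ∃ C, ∀ x : Rd d, ‖f x‖ * Real.exp (n * ‖x‖) ≤ C

lemma ExpDecay.superExp {d : ℕ} {φ : Rd d → ℂ} (hφ : ExpDecay φ) (k : Fin d) (p : ℕ) :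
    SuperExp ((dop k)^[p] φ) := by
  refine ⟨(contDiff_dop_iterate hφ.1 k p).continuous, fun n => ?_⟩
  obtain ⟨C, hC⟩ := hφ.2 n (Pi.single k p)
  rw [pD_single] at hC
  exact ⟨C, hC⟩

lemma ExpDecay.superExp_self {d : ℕ} {φ : Rd d → ℂ} (hφ : ExpDecay φ) : SuperExp φ := by
  refine ⟨hφ.1.continuous, fun n => ?_⟩
  obtain ⟨C, hC⟩ := hφ.2 n 0
  rw [pD_zero] at hC
  exact ⟨C, hC⟩

namespace SuperExp

variable {d : ℕ} {f : Rd d → ℂ}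

lemma exists_le (hf : SuperExp f) (a : ℝ) :
    ∃ C, ∀ x, ‖f x‖ * Real.exp (a * ‖x‖) ≤ C * Real.exp (-‖x‖) := by
  obtain ⟨n, hn⟩ := exists_nat_ge (a + 1)
  obtain ⟨C, hC⟩ := hf.2 n
  refine ⟨C, fun x => ?_⟩
  calc ‖f x‖ * Real.exp (a * ‖x‖) ≤ ‖f x‖ * Real.exp (n * ‖x‖ + -‖x‖) := by
        gcongr; nlinarith [norm_nonneg x]
    _ = ‖f x‖ * Real.exp (n * ‖x‖) * Real.exp (-‖x‖) := by rw [Real.exp_add]; ring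
    _ ≤ _ := by gcongr; exact hC x

lemma integrable (hf : SuperExp f) : Integrable f := by
  obtain ⟨C, hC⟩ := hf.exists_le 0
  refine ((integrable_exp_neg_norm d).const_mul C).mono' hf.1.aestronglyMeasurable
    (Eventually.of_forall fun x => ?_)
  simpa using hC x

lemma integrable_mul_expKer (hf : SuperExp f) (ζ : Fin d → ℂ) :
    Integrable fun x => f x * expKer (-x) ζ := by
  obtain ⟨C, hC⟩ := hf.exists_le (2 * Real.pi * d * ‖ζ‖)
  refine ((integrable_exp_neg_norm d).const_mul C).mono'
    (hf.1.mul (continuous_expKer_left ζ)).aestronglyMeasurable (Eventually.of_forall fun x => ?_)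
  rw [norm_mul]
  refine le_trans ?_ (hC x)
  gcongr
  simpa using norm_expKer_le (-x) ζ

lemma differentiable_lapl (hf : SuperExp f) : Differentiable ℂ (lapl f) := by
  intro ζ
  have hpi := Real.pi_pos
  obtain ⟨C, hC⟩ := hf.exists_le (2 * Real.pi * d * (‖ζ‖ + 1) + 1)
  have hphase : Continuous fun x : Rd d => phaseCLM (-x) := by
    unfold phaseCLM
    fun_prop
  refine (hasFDerivAt_integral_of_dominated_of_fderiv_le (𝕜 := ℂ) (Metric.ball_mem_nhds ζ one_pos)
    (F := fun ζ x => f x * expKer (-x) ζ)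
    (F' := fun ζ x => f x • (expKer (-x) ζ • phaseCLM (-x)))
    (bound := fun x => 2 * Real.pi * d * C * Real.exp (-‖x‖))
    (Eventually.of_forall fun ζ => (hf.integrable_mul_expKer ζ).aestronglyMeasurable)
    (hf.integrable_mul_expKer ζ) ?_ ?_ ((integrable_exp_neg_norm d).const_mul _) ?_).differentiableAt
  · exact (hf.1.smul ((continuous_expKer_left ζ).smul hphase)).aestronglyMeasurable
  · refine Eventually.of_forall fun x z hz => ?_
    have h1 : ‖z‖ ≤ ‖ζ‖ + 1 := by
      rw [mem_ball_iff_norm] at hz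
      have := norm_le_norm_add_norm_sub' z ζ
      linarith
    have h2 : ‖expKer (-x) z‖ ≤ Real.exp (2 * Real.pi * d * (‖ζ‖ + 1) * ‖x‖) := by
      refine (norm_expKer_le (-x) z).trans (Real.exp_le_exp.2 ?_)
      rw [norm_neg]
      gcongr
    have h3 : ‖phaseCLM (-x)‖ ≤ 2 * Real.pi * d * Real.exp ‖x‖ := by
      refine (norm_phaseCLM_le (-x)).trans ?_
      rw [norm_neg]
      gcongr
      linarith [Real.add_one_le_exp ‖x‖]
    rw [norm_smul, norm_smul]
    calc ‖f x‖ * (‖expKer (-x) z‖ * ‖phaseCLM (-x)‖)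
        ≤ ‖f x‖ * (Real.exp (2 * Real.pi * d * (‖ζ‖ + 1) * ‖x‖) *
          (2 * Real.pi * d * Real.exp ‖x‖)) := by gcongr
      _ = 2 * Real.pi * d * (‖f x‖ * Real.exp ((2 * Real.pi * d * (‖ζ‖ + 1) + 1) * ‖x‖)) := by
          rw [add_mul _ 1, one_mul, Real.exp_add]; ring
      _ ≤ 2 * Real.pi * d * (C * Real.exp (-‖x‖)) :=
          mul_le_mul_of_nonneg_left (hC x) (by positivity)
      _ = _ := by ring
  · exact Eventually.of_forall fun x z _ => (hasFDerivAt_expKer (-x) z).const_mul (f x)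

end SuperExp

lemma lapl_dop {d : ℕ} {f : Rd d → ℂ} {k : Fin d} (hd : Differentiable ℝ f) (hf : SuperExp f)
    (hf' : SuperExp (dop k f)) (ζ : Fin d → ℂ) :
    lapl (dop k f) ζ = 2 * Real.pi * Complex.I * ζ k * lapl f ζ := by
  have hder : ∀ x : Rd d, HasFDerivAt (fun x : Rd d => expKer (-x) ζ)
      (expKer (-x) ζ • -((2 * Real.pi * Complex.I : ℂ) • ∑ k, ζ k •
        Complex.ofRealCLM.comp (EuclideanSpace.proj (𝕜 := ℝ) k))) x := by
    intro x
    set L : Rd d →L[ℝ] ℂ := -((2 * Real.pi * Complex.I : ℂ) • ∑ k, ζ k •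
        Complex.ofRealCLM.comp (EuclideanSpace.proj (𝕜 := ℝ) k)) with hL
    have h : (fun x : Rd d => expKer (-x) ζ) = fun x => Complex.exp (L x) := by
      funext x
      simp [expKer, hL, mul_comm]
    rw [h]
    have h2 : expKer (-x) ζ = Complex.exp (L x) := congrFun h x
    rw [h2]
    exact L.hasFDerivAt.cexp
  have hval : ∀ x : Rd d, fderiv ℝ (fun x : Rd d => expKer (-x) ζ) x
      (EuclideanSpace.single k (1 : ℝ)) = -(2 * Real.pi * Complex.I * ζ k) * expKer (-x) ζ := by
    intro x
    rw [(hder x).fderiv]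
    simp [PiLp.single_apply, apply_ite Complex.ofReal]
    ring
  have h := integral_mul_fderiv_eq_neg_fderiv_mul_of_integrable (μ := (volume : Measure (Rd d)))
    (f := f) (g := fun x : Rd d => expKer (-x) ζ) (v := EuclideanSpace.single k (1 : ℝ))
    (hf'.integrable_mul_expKer ζ) ?_ (hf.integrable_mul_expKer ζ) (fun x _ => hd x)
    (fun x _ => (hder x).differentiableAt)
  · simp only [hval] at h
    have h2 : ∀ x, f x * (-(2 * Real.pi * Complex.I * ζ k) * expKer (-x) ζ) =
        -(2 * Real.pi * Complex.I * ζ k) * (f x * expKer (-x) ζ) := fun x => by ring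
    simp only [h2, integral_const_mul] at h
    rw [neg_mul] at h
    exact (neg_injective h).symm
  · refine ((hf.integrable_mul_expKer ζ).const_mul (-(2 * Real.pi * Complex.I * ζ k))).congr
      (Eventually.of_forall fun x => ?_)
    simp only [hval]
    ring

lemma ExpDecay.lapl_dop_iterate {d : ℕ} {φ : Rd d → ℂ} (hφ : ExpDecay φ) (k : Fin d) (p : ℕ)
    (ζ : Fin d → ℂ) :
    lapl ((dop k)^[p] φ) ζ = (2 * Real.pi * Complex.I * ζ k) ^ p * lapl φ ζ := by
  induction p with
  | zero => simp
  | succ p ih =>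
    have h := hφ.superExp k (p + 1)
    rw [Function.iterate_succ_apply'] at h ⊢
    rw [lapl_dop ((contDiff_dop_iterate hφ.1 k p).differentiable (by simp)) (hφ.superExp k p) h, ih]
    ring

lemma norm_lapl_toC_le {d : ℕ} {f : Rd d → ℂ} {n : ℕ} {R C : ℝ} (hR : 2 * Real.pi * R + 1 ≤ n)
    (hf : ∀ x, ‖f x‖ * Real.exp (n * ‖x‖) ≤ C) (ξ η : Rd d) (hη : ‖η‖ ≤ R) :
    ‖lapl f (toC ξ η)‖ ≤ C * ∫ x : Rd d, Real.exp (-‖x‖) := by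
  rw [← integral_const_mul]
  refine norm_integral_le_of_norm_le ((integrable_exp_neg_norm d).const_mul C)
    (Eventually.of_forall fun x => ?_)
  have hpi := Real.pi_pos
  rw [norm_mul]
  calc ‖f x‖ * ‖expKer (-x) (toC ξ η)‖ ≤ ‖f x‖ * Real.exp (n * ‖x‖ + -‖x‖) := by
        gcongr
        refine (norm_expKer_neg_toC_le x ξ η).trans (Real.exp_le_exp.2 ?_)
        have h1 : ‖x‖ * (2 * Real.pi * ‖η‖) ≤ ‖x‖ * (n - 1) := by
          gcongr
          have : 2 * Real.pi * ‖η‖ ≤ 2 * Real.pi * R := by gcongr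
          linarith
        linarith
    _ = ‖f x‖ * Real.exp (n * ‖x‖) * Real.exp (-‖x‖) := by rw [Real.exp_add]; ring
    _ ≤ _ := by gcongr; exact hf x

/-- Decay of the Fourier–Laplace transform on tubes. -/
lemma IsWeightSeq.stripBd_lapl {M : ℕ → ℝ} (hM : IsWeightSeq M) {d : ℕ} {φ : Rd d → ℂ}
    (hφ : ExpDecay φ) {h : ℝ} (hh : 0 < h) {n : ℕ} {R C : ℝ} (hR : 2 * Real.pi * R + 1 ≤ n)
    (hC : ∀ (α : Fin d → ℕ) (x : Rd d),
      h ^ msize α * ‖pD α φ x‖ * Real.exp (n * ‖x‖) ≤ C * M (msize α)) :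
    StripBd M (2 * Real.pi * h / (d + 1)) R (C * ∫ x : Rd d, Real.exp (-‖x‖)) (lapl φ) := by
  intro ξ η hη
  have hpi := Real.pi_pos
  set I := ∫ x : Rd d, Real.exp (-‖x‖)
  rw [mul_comm]
  refine hM.assocW_mul_le (by positivity) (norm_nonneg _) fun p => ?_
  have hzero : ‖lapl φ (toC ξ η)‖ ≤ C * I := by
    refine norm_lapl_toC_le hR (fun x => ?_) ξ η hη
    have := hC 0 x
    simpa [pD_zero, msize, hM.2.1] using this
  have hCI : 0 ≤ C * I := (norm_nonneg _).trans hzero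
  have hMp := hM.pos p
  rcases norm_eq_zero_or_exists_coord ξ with h0 | ⟨k, hk⟩
  · rw [h0, mul_zero]
    rcases Nat.eq_zero_or_pos p with rfl | hp
    · simpa [hM.2.1] using hzero
    · rw [zero_pow hp.ne', zero_mul]
      positivity
  · have h1 : ‖lapl ((dop k)^[p] φ) (toC ξ η)‖ ≤ C * M p / h ^ p * I := by
      refine norm_lapl_toC_le hR (fun x => ?_) ξ η hη
      have := hC (Pi.single k p) x
      rw [msize_single, pD_single] at this
      rw [le_div_iff₀ (by positivity)]
      linarith
    rw [hφ.lapl_dop_iterate, norm_mul, norm_pow, norm_mul, norm_two_pi_I] at h1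
    have h2 : ‖ξ‖ / (d + 1) ≤ ‖toC ξ η k‖ := by
      refine hk.trans ((le_of_eq ?_).trans (Complex.abs_re_le_norm _))
      simp [toC]
    calc (2 * Real.pi * h / (d + 1) * ‖ξ‖) ^ p * ‖lapl φ (toC ξ η)‖
        = h ^ p * ((2 * Real.pi * (‖ξ‖ / (d + 1))) ^ p * ‖lapl φ (toC ξ η)‖) := by
          rw [← mul_assoc, ← mul_pow]; congr 2; ring
      _ ≤ h ^ p * ((2 * Real.pi * ‖toC ξ η k‖) ^ p * ‖lapl φ (toC ξ η)‖) := by gcongr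
      _ ≤ h ^ p * (C * M p / h ^ p * I) := by gcongr
      _ = _ := by field_simp

lemma lapl_toC_zero {d : ℕ} (φ : Rd d → ℂ) (ξ : Rd d) :
    lapl φ (toC ξ 0) = FourierTransform.fourier φ ξ := by
  rw [lapl, Real.fourier_eq]
  refine integral_congr_ae (Eventually.of_forall fun x => ?_)
  simp only [expKer_eq_fourierChar, Circle.smul_def, smul_eq_mul, inner_neg_right,
    real_inner_comm, mul_comm]

lemma invLap_congr {d : ℕ} {g₁ g₂ : (Fin d → ℂ) → ℂ} (h : ∀ ξ : Rd d, g₁ (toC ξ 0) = g₂ (toC ξ 0)) :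
    invLap g₁ = invLap g₂ := by
  funext x
  simp only [invLap, h]

lemma invLap_lapl {d : ℕ} {φ : Rd d → ℂ} (hφ : SuperExp φ) (hl : RapidDecay (lapl φ)) :
    invLap (lapl φ) = φ := by
  have h := hl.integrable
  rw [invLap_eq_fourierInv]
  simp only [lapl_toC_zero] at h ⊢
  exact hφ.1.fourierInv_fourier_eq hφ.integrable h

lemma lapl_invLap {d : ℕ} {g : (Fin d → ℂ) → ℂ} (hg : RapidDecay g) (hU : Integrable (invLap g))
    (ξ : Rd d) : lapl (invLap g) (toC ξ 0) = g (toC ξ 0) := by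
  rw [lapl_toC_zero]
  have h : Integrable (FourierTransform.fourier fun ξ : Rd d => g (toC ξ 0)) := by
    refine hU.comp_neg.congr (Eventually.of_forall fun x => ?_)
    simp only [invLap_eq_fourierInv, Real.fourierInv_eq_fourier_neg, neg_neg]
  rw [invLap_eq_fourierInv, hg.1.fourier_fourierInv_eq hg.integrable h]

lemma expKer_sub {d : ℕ} (x t : Rd d) (ζ : Fin d → ℂ) :
    expKer (x - t) ζ = expKer (-t) ζ * expKer x ζ := by
  rw [expKer, expKer, expKer, ← Complex.exp_add, ← mul_add, ← Finset.sum_add_distrib]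
  congr 2
  refine Finset.sum_congr rfl fun k _ => ?_
  simp only [PiLp.sub_apply, PiLp.neg_apply]
  push_cast
  ring

lemma convF_invLap {d : ℕ} {ψ : Rd d → ℂ} {g : (Fin d → ℂ) → ℂ} (hψ : SuperExp ψ)
    (hg : RapidDecay g) : convF ψ (invLap g) = invLap fun ζ => lapl ψ ζ * g ζ := by
  funext x
  have hint : Integrable (Function.uncurry fun t ξ : Rd d =>
      ψ t * (g (toC ξ 0) * expKer (x - t) (toC ξ 0))) (volume.prod volume) := by
    have h1 := hψ.integrable.mul_prod hg.integrable
    refine h1.norm.mono' ?_ (Eventually.of_forall fun p => ?_)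
    · have h2 : Continuous fun p : Rd d × Rd d => ψ p.1 := hψ.1.comp continuous_fst
      have h3 : Continuous fun p : Rd d × Rd d => g (toC p.2 0) := hg.1.comp continuous_snd
      have h4 : Continuous fun p : Rd d × Rd d => expKer (x - p.1) (toC p.2 0) := by
        unfold expKer toC
        fun_prop
      exact (h2.mul (h3.mul h4)).aestronglyMeasurable
    · simp [Function.uncurry, norm_expKer_toC_zero]
  calc convF ψ (invLap g) x
      = ∫ t, ∫ ξ : Rd d, ψ t * (g (toC ξ 0) * expKer (x - t) (toC ξ 0)) := by
        simp only [convF, invLap, integral_const_mul]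
    _ = ∫ ξ : Rd d, ∫ t, ψ t * (g (toC ξ 0) * expKer (x - t) (toC ξ 0)) :=
        integral_integral_swap hint
    _ = _ := by
        rw [invLap]
        refine integral_congr_ae (Eventually.of_forall fun ξ => ?_)
        simp only [lapl, ← integral_mul_const]
        refine integral_congr_ae (Eventually.of_forall fun t => ?_)
        simp only [expKer_sub]
        ring

/-- The bound `p_{k,n}(φ) ≤ C` for the seminorms defining the spaces `𝒦^{[M]}`. -/
def SemiBd {d : ℕ} (M : ℕ → ℝ) (k : ℝ) (n : ℕ) (C : ℝ) (φ : Rd d → ℂ) : Prop :=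
  ∀ (α : Fin d → ℕ) (x : Rd d),
    k ^ msize α * ‖pD α φ x‖ * Real.exp ((n : ℝ) * ‖x‖) ≤ C * M (msize α)

/-- Entire functions with the decay of order `h` on every tube. -/
def TubeDecay {d : ℕ} (M : ℕ → ℝ) (h : ℝ) (g : (Fin d → ℂ) → ℂ) : Prop :=
  Differentiable ℂ g ∧ ∀ R, ∃ C, StripBd M h R C g

lemma SemiBd.expDecay {d : ℕ} {M : ℕ → ℝ} {k : ℝ} {φ : Rd d → ℂ} (hφ : ContDiff ℝ (⊤ : ℕ∞) φ)
    (hk : 0 < k) (h : ∀ n, ∃ C, SemiBd M k n C φ) : ExpDecay φ := by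
  refine ⟨hφ, fun n α => ?_⟩
  obtain ⟨C, hC⟩ := h n
  refine ⟨C * M (msize α) / k ^ msize α, fun x => ?_⟩
  rw [le_div_iff₀' (by positivity), ← mul_assoc]
  exact hC α x

namespace IsWeightSeq

variable {M : ℕ → ℝ} {C₀ H h : ℝ} {d : ℕ}

lemma stripBd_mono (hM : IsWeightSeq M) {h' R R' C : ℝ} {g : (Fin d → ℂ) → ℂ} (hh : h ≤ h')
    (hR : R ≤ R') (hg : StripBd M h' R' C g) : StripBd M h R C g := by
  intro ξ η hη
  refine le_trans ?_ (hg ξ η (hη.trans hR))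
  gcongr
  exact hM.assocW_mono (by gcongr)

lemma tubeDecay_mul (hM : IsWeightSeq M) {g₁ g₂ : (Fin d → ℂ) → ℂ} (h₁ : TubeDecay M h g₁)
    (h₂ : TubeDecay M h g₂) : TubeDecay M h fun ζ => g₁ ζ * g₂ ζ := by
  refine ⟨h₁.1.mul h₂.1, fun R => ?_⟩
  obtain ⟨C₁, hC₁⟩ := h₁.2 R
  obtain ⟨C₂, hC₂⟩ := h₂.2 R
  refine ⟨C₁ * C₂, fun ξ η hη => ?_⟩
  have h3 := hC₁ ξ η hη
  have h4 := hC₂ ξ η hη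
  have h5 := hM.one_le_assocW (h * ‖ξ‖)
  have h6 : ‖g₁ (toC ξ η)‖ ≤ C₁ := (le_mul_of_one_le_right (norm_nonneg _) h5).trans h3
  rw [norm_mul, mul_assoc]
  exact mul_le_mul h6 h4 (by positivity) ((norm_nonneg _).trans h6)

lemma rapidDecay_of_tubeDecay (hM : IsWeightSeq M) (hh : 0 < h) {g : (Fin d → ℂ) → ℂ}
    (hg : TubeDecay M h g) : RapidDecay g := by
  obtain ⟨C, hC⟩ := hg.2 0
  exact hM.rapidDecay_of_stripBd hh hg.1.continuous hC

lemma exists_semiBd_invLap (hM : IsWeightSeq M) (h2 : HasM2 M C₀ H) (hh : 0 < h)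
    {S : Set ((Fin d → ℂ) → ℂ)} (hd : ∀ g ∈ S, Differentiable ℂ g)
    (hb : ∀ R, ∃ C, ∀ g ∈ S, StripBd M h R C g) (n : ℕ) :
    ∃ C, ∀ g ∈ S, SemiBd M (h / (4 * Real.pi * H)) n C (invLap g) := by
  obtain ⟨J, R, -, hJ⟩ := hM.exists_seminorm_bound h2 hh d n
  obtain ⟨C, hC⟩ := hb R
  refine ⟨J * C, fun g hg => hJ g (hd g hg) (fun R => ?_) C (hC g hg)⟩
  obtain ⟨C, hC⟩ := hb R
  exact ⟨C, hC g hg⟩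

lemma semiBd_invLap (hM : IsWeightSeq M) (h2 : HasM2 M C₀ H) (hh : 0 < h)
    {g : (Fin d → ℂ) → ℂ} (hg : TubeDecay M h g) (n : ℕ) :
    ∃ C, SemiBd M (h / (4 * Real.pi * H)) n C (invLap g) := by
  simpa using hM.exists_semiBd_invLap h2 hh (S := {g}) (by simpa using hg.1)
    (by simpa using hg.2) n

lemma expDecay_invLap (hM : IsWeightSeq M) (h2 : HasM2 M C₀ H) (hh : 0 < h)
    {g : (Fin d → ℂ) → ℂ} (hg : TubeDecay M h g) : ExpDecay (invLap g) := by
  have hH : 0 < H := zero_lt_one.trans_le h2.2.1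
  exact SemiBd.expDecay (hM.rapidDecay_of_tubeDecay hh hg).contDiff_invLap
    (div_pos hh (by positivity)) (hM.semiBd_invLap h2 hh hg)

lemma exists_stripBd_lapl (hM : IsWeightSeq M) (hh : 0 < h) {B : Set (Rd d → ℂ)}
    (hB : ∀ φ ∈ B, ExpDecay φ) (hb : ∀ n, ∃ C, ∀ φ ∈ B, SemiBd M h n C φ) (R : ℝ) :
    ∃ C, ∀ φ ∈ B, StripBd M (2 * Real.pi * h / (d + 1)) R C (lapl φ) := by
  obtain ⟨n, hn⟩ := exists_nat_ge (2 * Real.pi * R + 1)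
  obtain ⟨C, hC⟩ := hb n
  exact ⟨_, fun φ hφ => hM.stripBd_lapl (hB φ hφ) hh hn (hC φ hφ)⟩

lemma tubeDecay_lapl (hM : IsWeightSeq M) (hh : 0 < h) {φ : Rd d → ℂ}
    (hφ : ContDiff ℝ (⊤ : ℕ∞) φ) (hb : ∀ n, ∃ C, SemiBd M h n C φ) :
    TubeDecay M (2 * Real.pi * h / (d + 1)) (lapl φ) := by
  have hexp := SemiBd.expDecay hφ hh hb
  refine ⟨hexp.superExp_self.differentiable_lapl, fun R => ?_⟩
  simpa using hM.exists_stripBd_lapl hh (B := {φ}) (by simpa using hexp) (by simpa using hb) R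

lemma convF_eq_invLap_mul (hM : IsWeightSeq M) (hh : 0 < h) {ψ χ : Rd d → ℂ} (hψ : ExpDecay ψ)
    (hχ : ExpDecay χ) (hl : TubeDecay M h (lapl χ)) :
    convF ψ χ = invLap fun ζ => lapl ψ ζ * lapl χ ζ := by
  have h1 := hM.rapidDecay_of_tubeDecay hh hl
  conv_lhs => rw [← invLap_lapl hχ.superExp_self h1]
  exact convF_invLap hψ.superExp_self h1

lemma convF_invLap_inv_mul (hM : IsWeightSeq M) (h2 : HasM2 M C₀ H) {h₁ h₂ : ℝ} (hh : 0 < h)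
    (hh₁ : 0 < h₁) (hh₂ : 0 < h₂) {G : (Fin d → ℂ) → ℂ} (hG0 : ∀ ζ, G ζ ≠ 0)
    (hG : TubeDecay M h fun ζ => (G ζ)⁻¹) {φ : Rd d → ℂ} (hφ : ExpDecay φ)
    (hl : TubeDecay M h₁ (lapl φ)) (hGl : TubeDecay M h₂ fun ζ => G ζ * lapl φ ζ) :
    convF (invLap fun ζ => (G ζ)⁻¹) (invLap fun ζ => G ζ * lapl φ ζ) = φ := by
  have hψ := (hM.expDecay_invLap h2 hh hG).superExp_self
  rw [convF_invLap hψ (hM.rapidDecay_of_tubeDecay hh₂ hGl)]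
  conv_rhs => rw [← invLap_lapl hφ.superExp_self (hM.rapidDecay_of_tubeDecay hh₁ hl)]
  refine invLap_congr fun ξ => ?_
  rw [lapl_invLap (hM.rapidDecay_of_tubeDecay hh hG) hψ.integrable, inv_mul_cancel_left₀ (hG0 _)]

lemma tubeDecay_expFactor_inv (hM : IsWeightSeq M) {ω : ℝ → ℝ} {K : ℕ} (hω : Moderate ω K)
    {C : ℝ} (hC : ∀ t, 0 ≤ t → Real.log (assocW M (h * t)) ≤ ω (t / (d + 1)) / 2 + C) :
    TubeDecay M h fun ζ => (expFactor d ω ζ)⁻¹ := by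
  refine ⟨(hω.differentiable_expFactor d).inv fun ζ => Complex.exp_ne_zero _, fun R => ?_⟩
  obtain ⟨D, hD⟩ := hω.norm_expFactor_le d R
  refine ⟨Real.exp (D + C), fun ξ η hη => ?_⟩
  have hW := hM.assocW_pos (h * ‖ξ‖)
  calc ‖(expFactor d ω (toC ξ η))⁻¹‖ * assocW M (h * ‖ξ‖)
      ≤ Real.exp (D - ω (‖ξ‖ / (d + 1)) / 2) * Real.exp (ω (‖ξ‖ / (d + 1)) / 2 + C) := by
        gcongr
        · exact (hD ξ η hη).2
        · rw [← Real.log_le_iff_le_exp hW]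
          exact hC _ (norm_nonneg _)
    _ = _ := by rw [← Real.exp_add]; congr 1; ring

end IsWeightSeq

namespace IsWeightSeq

variable {M : ℕ → ℝ} {C₀ H h : ℝ} {d : ℕ}

lemma kBeu_invLap (hM : IsWeightSeq M) (hM2 : M2 M) {g : (Fin d → ℂ) → ℂ}
    (hg : ∀ h, 0 < h → TubeDecay M h g) : KBeu d M (invLap g) := by
  obtain ⟨C₀, H, h2⟩ := hM2
  have hH : 0 < H := zero_lt_one.trans_le h2.2.1
  have hpi := Real.pi_pos
  refine ⟨(hM.rapidDecay_of_tubeDecay one_pos (hg 1 one_pos)).contDiff_invLap, fun k hk n => ?_⟩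
  have hh : 0 < 4 * Real.pi * H * k := by positivity
  have := hM.semiBd_invLap h2 hh (hg _ hh) n
  rwa [mul_div_cancel_left₀ _ (by positivity)] at this

lemma kRou_invLap (hM : IsWeightSeq M) (hM2 : M2 M) (hh : 0 < h) {g : (Fin d → ℂ) → ℂ}
    (hg : TubeDecay M h g) : KRou d M (invLap g) := by
  obtain ⟨C₀, H, h2⟩ := hM2
  have hH : 0 < H := zero_lt_one.trans_le h2.2.1
  exact ⟨(hM.rapidDecay_of_tubeDecay hh hg).contDiff_invLap, h / (4 * Real.pi * H),
    div_pos hh (by positivity), fun n => hM.semiBd_invLap h2 hh hg n⟩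

lemma kBeuBdd_invLap (hM : IsWeightSeq M) (hM2 : M2 M) {S : Set ((Fin d → ℂ) → ℂ)}
    (hd : ∀ g ∈ S, Differentiable ℂ g)
    (hb : ∀ h, 0 < h → ∀ R, ∃ C, ∀ g ∈ S, StripBd M h R C g) : KBeuBdd d M (invLap '' S) := by
  refine ⟨?_, fun k hk n => ?_⟩
  · rintro _ ⟨g, hg, rfl⟩
    refine hM.kBeu_invLap hM2 fun h hh => ⟨hd g hg, fun R => ?_⟩
    obtain ⟨C, hC⟩ := hb h hh R
    exact ⟨C, hC g hg⟩
  · obtain ⟨C₀, H, h2⟩ := hM2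
    have hH : 0 < H := zero_lt_one.trans_le h2.2.1
    have hpi := Real.pi_pos
    have hh : 0 < 4 * Real.pi * H * k := by positivity
    obtain ⟨C, hC⟩ := hM.exists_semiBd_invLap h2 hh hd (hb _ hh) n
    rw [mul_div_cancel_left₀ _ (by positivity)] at hC
    exact ⟨C, by rintro _ ⟨g, hg, rfl⟩; exact hC g hg⟩

lemma kRouBdd_invLap (hM : IsWeightSeq M) (hM2 : M2 M) (hh : 0 < h) {S : Set ((Fin d → ℂ) → ℂ)}
    (hd : ∀ g ∈ S, Differentiable ℂ g) (hb : ∀ R, ∃ C, ∀ g ∈ S, StripBd M h R C g) :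
    KRouBdd d M (invLap '' S) := by
  refine ⟨?_, ?_⟩
  · rintro _ ⟨g, hg, rfl⟩
    refine hM.kRou_invLap hM2 hh ⟨hd g hg, fun R => ?_⟩
    obtain ⟨C, hC⟩ := hb R
    exact ⟨C, hC g hg⟩
  · obtain ⟨C₀, H, h2⟩ := hM2
    have hH : 0 < H := zero_lt_one.trans_le h2.2.1
    refine ⟨h / (4 * Real.pi * H), div_pos hh (by positivity), fun n => ?_⟩
    obtain ⟨C, hC⟩ := hM.exists_semiBd_invLap h2 hh hd hb n
    exact ⟨C, by rintro _ ⟨g, hg, rfl⟩; exact hC g hg⟩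

lemma tubeDecay_lapl_of_kBeu (hM : IsWeightSeq M) {φ : Rd d → ℂ} (hφ : KBeu d M φ) (hh : 0 < h) :
    TubeDecay M h (lapl φ) := by
  have hpi := Real.pi_pos
  have hk : 0 < h * (d + 1) / (2 * Real.pi) := by positivity
  have := hM.tubeDecay_lapl hk hφ.1 (hφ.2 _ hk)
  rwa [mul_div_cancel₀ _ (by positivity), mul_div_cancel_right₀ _ (by positivity)] at this

lemma exists_tubeDecay_lapl_of_kRou (hM : IsWeightSeq M) {φ : Rd d → ℂ} (hφ : KRou d M φ) :
    ∃ h, 0 < h ∧ TubeDecay M h (lapl φ) := by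
  obtain ⟨hc, k, hk, hb⟩ := hφ
  exact ⟨_, by positivity, hM.tubeDecay_lapl hk hc hb⟩

lemma tubeDecay_mono (hM : IsWeightSeq M) {h' : ℝ} {g : (Fin d → ℂ) → ℂ} (hh : h ≤ h')
    (hg : TubeDecay M h' g) : TubeDecay M h g := by
  refine ⟨hg.1, fun R => ?_⟩
  obtain ⟨C, hC⟩ := hg.2 R
  exact ⟨C, hM.stripBd_mono hh le_rfl hC⟩

end IsWeightSeq

lemma KBeu.expDecay {d : ℕ} {M : ℕ → ℝ} {φ : Rd d → ℂ} (hφ : KBeu d M φ) : ExpDecay φ :=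
  SemiBd.expDecay hφ.1 one_pos (hφ.2 1 one_pos)

lemma KRou.expDecay {d : ℕ} {M : ℕ → ℝ} {φ : Rd d → ℂ} (hφ : KRou d M φ) : ExpDecay φ := by
  obtain ⟨hc, k, hk, hb⟩ := hφ
  exact SemiBd.expDecay hc hk hb

lemma KBeu.convF {d : ℕ} {M : ℕ → ℝ} (hM : IsWeightSeq M) (hM2 : M2 M) {ψ χ : Rd d → ℂ}
    (hψ : KBeu d M ψ) (hχ : KBeu d M χ) : KBeu d M (convF ψ χ) := by
  rw [hM.convF_eq_invLap_mul one_pos hψ.expDecay hχ.expDecay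
    (hM.tubeDecay_lapl_of_kBeu hχ one_pos)]
  exact hM.kBeu_invLap hM2 fun h hh =>
    hM.tubeDecay_mul (hM.tubeDecay_lapl_of_kBeu hψ hh) (hM.tubeDecay_lapl_of_kBeu hχ hh)

lemma KRou.convF {d : ℕ} {M : ℕ → ℝ} (hM : IsWeightSeq M) (hM2 : M2 M) {ψ χ : Rd d → ℂ}
    (hψ : KRou d M ψ) (hχ : KRou d M χ) : KRou d M (convF ψ χ) := by
  obtain ⟨h₁, hh₁, hl₁⟩ := hM.exists_tubeDecay_lapl_of_kRou hψ
  obtain ⟨h₂, hh₂, hl₂⟩ := hM.exists_tubeDecay_lapl_of_kRou hχ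
  rw [hM.convF_eq_invLap_mul hh₂ hψ.expDecay hχ.expDecay hl₂]
  exact hM.kRou_invLap hM2 (lt_min hh₁ hh₂) (hM.tubeDecay_mul
    (hM.tubeDecay_mono (min_le_left _ _) hl₁) (hM.tubeDecay_mono (min_le_right _ _) hl₂))

lemma KBeuBdd.exists_factor {d : ℕ} {M : ℕ → ℝ} (hM : IsWeightSeq M) (hM2 : M2 M)
    (h2s : M2star M) {B : Set (Rd d → ℂ)} (hB : KBeuBdd d M B) :
    ∃ ψ : Rd d → ℂ, KBeu d M ψ ∧
      ∃ A : Set (Rd d → ℂ), KBeuBdd d M A ∧ (fun χ => convF ψ χ) '' A = B := by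
  have hpi := Real.pi_pos
  have hlapl : ∀ L R : ℕ, ∃ C, ∀ φ ∈ B, StripBd M L R C (lapl φ) := by
    intro L R
    have hk : 0 < ((L : ℝ) + 1) * (d + 1) / (2 * Real.pi) := by positivity
    obtain ⟨C, hC⟩ := hM.exists_stripBd_lapl hk (fun φ hφ => (hB.1 φ hφ).expDecay)
      (hB.2 _ hk) R
    rw [mul_div_cancel₀ _ (by positivity), mul_div_cancel_right₀ _ (by positivity)] at hC
    exact ⟨C, fun φ hφ => hM.stripBd_mono (by linarith) le_rfl (hC φ hφ)⟩
  choose c hc using hlapl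
  obtain ⟨ω, K, hω, hωM, hωc⟩ := hM.exists_moderate_of_family hM2 h2s d c
  set G := expFactor d ω with hG
  have hG0 : ∀ ζ, G ζ ≠ 0 := fun ζ => Complex.exp_ne_zero _
  have hinv : ∀ h, 0 < h → TubeDecay M h fun ζ => (G ζ)⁻¹ := by
    intro h _
    obtain ⟨N, hN⟩ := exists_nat_ge h
    obtain ⟨C, hC⟩ := hωM N
    exact hM.tubeDecay_mono hN (hM.tubeDecay_expFactor_inv hω hC)
  set S : Set ((Fin d → ℂ) → ℂ) := (fun φ ζ => G ζ * lapl φ ζ) '' B with hS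
  have hSd : ∀ g ∈ S, Differentiable ℂ g := by
    rintro _ ⟨φ, hφ, rfl⟩
    exact (hω.differentiable_expFactor d).mul (hB.1 φ hφ).expDecay.superExp_self.differentiable_lapl
  have hSb : ∀ h, 0 < h → ∀ R, ∃ C, ∀ g ∈ S, StripBd M h R C g := by
    intro h _ R
    obtain ⟨N, hN⟩ := exists_nat_ge h
    obtain ⟨R', hR'⟩ := exists_nat_ge R
    obtain ⟨C, hC⟩ := hωc N R'
    obtain ⟨D, hD⟩ := hω.norm_expFactor_le d R'
    refine ⟨Real.exp D * C, ?_⟩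
    rintro _ ⟨φ, hφ, rfl⟩
    refine hM.stripBd_mono hN hR' fun ξ η hη => ?_
    have hW := hM.assocW_pos (N * ‖ξ‖)
    have h1 := hC ‖ξ‖ ‖lapl φ (toC ξ η)‖ (norm_nonneg _) (norm_nonneg _)
      fun L => hc L R' φ hφ ξ η hη
    beta_reduce
    rw [norm_mul]
    calc ‖G (toC ξ η)‖ * ‖lapl φ (toC ξ η)‖ * assocW M (N * ‖ξ‖)
        ≤ Real.exp (D + 2 * d * ω ‖ξ‖) * ‖lapl φ (toC ξ η)‖ * assocW M (N * ‖ξ‖) := by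
          gcongr; exact (hD ξ η hη).1
      _ = Real.exp D *
          (‖lapl φ (toC ξ η)‖ * Real.exp (2 * d * ω ‖ξ‖) * assocW M (N * ‖ξ‖)) := by
          rw [Real.exp_add]; ring
      _ ≤ _ := by gcongr
  refine ⟨invLap fun ζ => (G ζ)⁻¹, hM.kBeu_invLap hM2 hinv, invLap '' S,
    hM.kBeuBdd_invLap hM2 hSd hSb, ?_⟩
  obtain ⟨C₀, H, h2⟩ := hM2
  have hfac : ∀ φ ∈ B, convF (invLap fun ζ => (G ζ)⁻¹) (invLap fun ζ => G ζ * lapl φ ζ) = φ := by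
    intro φ hφ
    refine hM.convF_invLap_inv_mul h2 one_pos one_pos one_pos hG0 (hinv 1 one_pos)
      (hB.1 φ hφ).expDecay (hM.tubeDecay_lapl_of_kBeu (hB.1 φ hφ) one_pos)
      ⟨hSd _ ⟨φ, hφ, rfl⟩, fun R => ?_⟩
    obtain ⟨C, hC⟩ := hSb 1 one_pos R
    exact ⟨C, hC _ ⟨φ, hφ, rfl⟩⟩
  rw [hS, Set.image_image, Set.image_image]
  exact (Set.image_congr hfac).trans (Set.image_id' B)

lemma KRouBdd.exists_factor {d : ℕ} {M : ℕ → ℝ} (hM : IsWeightSeq M) (hM2 : M2 M)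
    (h2s : M2star M) {B : Set (Rd d → ℂ)} (hB : KRouBdd d M B) :
    ∃ ψ : Rd d → ℂ, KRou d M ψ ∧
      ∃ A : Set (Rd d → ℂ), KRouBdd d M A ∧ (fun χ => convF ψ χ) '' A = B := by
  have hpi := Real.pi_pos
  obtain ⟨hBK, k, hk, hBb⟩ := hB
  have hlapl := hM.exists_stripBd_lapl hk (fun φ hφ => (hBK φ hφ).expDecay) hBb
  set h := 2 * Real.pi * k / (d + 1) with hhdef
  have hh : 0 < h := by positivity
  obtain ⟨ω, K, h', C, hω, hh', hωC⟩ := hM.exists_moderate_of_dilation hM2 h2s d hh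
  set G := expFactor d ω with hG
  have hG0 : ∀ ζ, G ζ ≠ 0 := fun ζ => Complex.exp_ne_zero _
  have hinv : TubeDecay M h' fun ζ => (G ζ)⁻¹ :=
    hM.tubeDecay_expFactor_inv hω fun t ht => (hωC t ht).1
  set S : Set ((Fin d → ℂ) → ℂ) := (fun φ ζ => G ζ * lapl φ ζ) '' B with hS
  have hld : ∀ φ ∈ B, Differentiable ℂ (lapl φ) := fun φ hφ =>
    (hBK φ hφ).expDecay.superExp_self.differentiable_lapl
  have hSd : ∀ g ∈ S, Differentiable ℂ g := by
    rintro _ ⟨φ, hφ, rfl⟩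
    exact (hω.differentiable_expFactor d).mul (hld φ hφ)
  have hSb : ∀ R, ∃ C, ∀ g ∈ S, StripBd M h' R C g := by
    intro R
    obtain ⟨A, hA⟩ := hlapl R
    obtain ⟨D, hD⟩ := hω.norm_expFactor_le d R
    refine ⟨Real.exp (D + C) * A, ?_⟩
    rintro _ ⟨φ, hφ, rfl⟩ ξ η hη
    have hW := hM.assocW_pos (h' * ‖ξ‖)
    have hW' := hM.assocW_pos (h * ‖ξ‖)
    have h1 : Real.exp (2 * d * ω ‖ξ‖) * assocW M (h' * ‖ξ‖) ≤
        assocW M (h * ‖ξ‖) * Real.exp C := by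
      have := Real.exp_le_exp.2 (hωC ‖ξ‖ (norm_nonneg _)).2
      rwa [Real.exp_add, Real.exp_add, Real.exp_log hW, Real.exp_log hW'] at this
    beta_reduce
    rw [norm_mul]
    calc ‖G (toC ξ η)‖ * ‖lapl φ (toC ξ η)‖ * assocW M (h' * ‖ξ‖)
        ≤ Real.exp (D + 2 * d * ω ‖ξ‖) * ‖lapl φ (toC ξ η)‖ * assocW M (h' * ‖ξ‖) := by
          gcongr; exact (hD ξ η hη).1
      _ = Real.exp D * ‖lapl φ (toC ξ η)‖ *
          (Real.exp (2 * d * ω ‖ξ‖) * assocW M (h' * ‖ξ‖)) := by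
          rw [Real.exp_add]; ring
      _ ≤ Real.exp D * ‖lapl φ (toC ξ η)‖ * (assocW M (h * ‖ξ‖) * Real.exp C) := by gcongr
      _ = Real.exp (D + C) * (‖lapl φ (toC ξ η)‖ * assocW M (h * ‖ξ‖)) := by
          rw [Real.exp_add]; ring
      _ ≤ _ := by gcongr; exact hA φ hφ ξ η hη
  refine ⟨invLap fun ζ => (G ζ)⁻¹, hM.kRou_invLap hM2 hh' hinv, invLap '' S,
    hM.kRouBdd_invLap hM2 hh' hSd hSb, ?_⟩
  obtain ⟨C₀, H, h2⟩ := hM2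
  have hfac : ∀ φ ∈ B, convF (invLap fun ζ => (G ζ)⁻¹) (invLap fun ζ => G ζ * lapl φ ζ) = φ := by
    intro φ hφ
    refine hM.convF_invLap_inv_mul h2 hh' hh hh' hG0 hinv (hBK φ hφ).expDecay
      ⟨hld φ hφ, fun R => ?_⟩ ⟨hSd _ ⟨φ, hφ, rfl⟩, fun R => ?_⟩
    · obtain ⟨C, hC⟩ := hlapl R
      exact ⟨C, hC φ hφ⟩
    · obtain ⟨C, hC⟩ := hSb R
      exact ⟨C, hC _ ⟨φ, hφ, rfl⟩⟩
  rw [hS, Set.image_image, Set.image_image]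
  exact (Set.image_congr hfac).trans (Set.image_id' B)

lemma kBeuBdd_singleton {d : ℕ} {M : ℕ → ℝ} {φ : Rd d → ℂ} (hφ : KBeu d M φ) :
    KBeuBdd d M {φ} := by
  refine ⟨by simpa using hφ, fun h hh n => ?_⟩
  simpa using hφ.2 h hh n

lemma kRouBdd_singleton {d : ℕ} {M : ℕ → ℝ} {φ : Rd d → ℂ} (hφ : KRou d M φ) :
    KRouBdd d M {φ} := by
  refine ⟨by simpa using hφ, ?_⟩
  obtain ⟨-, k, hk, hb⟩ := hφ
  exact ⟨k, hk, by simpa using hb⟩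

/-- The algebras `𝒦^{(M)}(ℝ^d)` and `𝒦^{{M}}(ℝ^d)` have the strong factorization
property (Corollary 7.14), including factorization of bounded sets. -/
theorem stmt17 (d : ℕ) (M : ℕ → ℝ) (hM : IsWeightSeq M) (hM2 : M2 M) (h2s : M2star M) :
    convSet {f | KBeu d M f} {f | KBeu d M f} = {f | KBeu d M f} ∧
    convSet {f | KRou d M f} {f | KRou d M f} = {f | KRou d M f} ∧
    (∀ B : Set (Rd d → ℂ), KBeuBdd d M B →
      ∃ ψ : Rd d → ℂ, KBeu d M ψ ∧
        ∃ A : Set (Rd d → ℂ), KBeuBdd d M A ∧ (fun χ => convF ψ χ) '' A = B) ∧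
    (∀ B : Set (Rd d → ℂ), KRouBdd d M B →
      ∃ ψ : Rd d → ℂ, KRou d M ψ ∧
        ∃ A : Set (Rd d → ℂ), KRouBdd d M A ∧ (fun χ => convF ψ χ) '' A = B) := by
  refine ⟨?_, ?_, fun B hB => hB.exists_factor hM hM2 h2s, fun B hB => hB.exists_factor hM hM2 h2s⟩
  · ext φ
    constructor
    · rintro ⟨ψ, hψ, χ, hχ, rfl⟩
      exact KBeu.convF hM hM2 hψ hχ
    · intro hφ
      obtain ⟨ψ, hψ, A, hA, hAB⟩ := (kBeuBdd_singleton hφ).exists_factor hM hM2 h2s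
      obtain ⟨χ, hχ, hconv⟩ := hAB.symm.subset (Set.mem_singleton φ)
      exact ⟨ψ, hψ, χ, hA.1 χ hχ, hconv.symm⟩
  · ext φ
    constructor
    · rintro ⟨ψ, hψ, χ, hχ, rfl⟩
      exact KRou.convF hM hM2 hψ hχ
    · intro hφ
      obtain ⟨ψ, hψ, A, hA, hAB⟩ := (kRouBdd_singleton hφ).exists_factor hM hM2 h2s
      obtain ⟨χ, hχ, hconv⟩ := hAB.symm.subset (Set.mem_singleton φ)
      exact ⟨ψ, hψ, χ, hA.1 χ hχ, hconv.symm⟩
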